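/- arXiv:1701.08557 — 2 statements merged into one kernel-verified Lean document; each statement's English description precedes it below -/
import Mathlib

section
/- There exists a constant $c_0 > 0$ such that for all integers $k, l$ with $2 \leq k \leq l$ there exists $N_0$ such that for every $N \geq N_0$ there is a circulant $N \times N$ Boolean matrix that is $(k,l)$-free and has weight at least $c_0 \cdot \frac{k+l}{k^2 l^2} \cdot N^{2 - \frac{k+l+2}{kl}}$. -/
open scoped Pointwise

/-- A pair of functions `x, y` respecting every coincidence among the sums `a + b` with `a ∈ A`,
`b ∈ B`. -/
def RespectsSums (A B : Finset ℤ) (x y : ℤ → ℤ) : Prop :=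
  ∀ a ∈ A, ∀ a' ∈ A, ∀ b ∈ B, ∀ b' ∈ B, a + b = a' + b' → x a + y b = x a' + y b'

/-- `T` generates the sums of `A` and `B`: a pair of functions respecting the coincidences among
these sums is determined on all sums by its values on the sums in `T`. -/
def GeneratesSums (A B T : Finset ℤ) : Prop :=
  ∀ x y : ℤ → ℤ, RespectsSums A B x y →
    (∀ a ∈ A, ∀ b ∈ B, a + b ∈ T → x a + y b = 0) → ∀ a ∈ A, ∀ b ∈ B, x a + y b = 0

lemma RespectsSums.mono {A A' B B' : Finset ℤ} {x y : ℤ → ℤ} (h : RespectsSums A B x y)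
    (hA : A' ⊆ A) (hB : B' ⊆ B) : RespectsSums A' B' x y :=
  fun a ha a' ha' b hb b' hb' => h a (hA ha) a' (hA ha') b (hB hb) b' (hB hb')

lemma RespectsSums.swap {A B : Finset ℤ} {x y : ℤ → ℤ} (h : RespectsSums A B x y) :
    RespectsSums B A y x := by
  intro b hb b' hb' a ha a' ha' e
  linarith [h a ha a' ha' b hb b' hb' (by linarith)]

lemma GeneratesSums.swap {A B T : Finset ℤ} (h : GeneratesSums A B T) : GeneratesSums B A T := by
  intro x y hxy hT b hb a ha
  rw [add_comm]
  exact h y x hxy.swap (fun a ha b hb hab => by rw [add_comm]; exact hT b hb a ha (by rwa [add_comm]))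
    a ha b hb

lemma GeneratesSums.nonempty {A B T : Finset ℤ} (h : GeneratesSums A B T) (hA : A.Nonempty)
    (hB : B.Nonempty) : T.Nonempty := by
  obtain ⟨a, ha⟩ := hA
  obtain ⟨b, hb⟩ := hB
  rw [Finset.nonempty_iff_ne_empty]
  rintro rfl
  simpa using h (fun _ => 1) (fun _ => 0) (fun _ _ _ _ _ _ _ _ _ => rfl) (by simp) a ha b hb

lemma generatesSums_add (A B : Finset ℤ) : GeneratesSums A B (A + B) :=
  fun _ _ _ hT a ha b hb => hT a ha b hb (Finset.add_mem_add ha hb)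

/-- A generating set for `A \ {a}` and `B` generates for `A` and `B` once some sum `a + b` is known
to vanish. -/
lemma GeneratesSums.of_erase_left {A B T T' : Finset ℤ} {a b : ℤ} (hb : b ∈ B)
    (hA' : (A.erase a).Nonempty) (hT : GeneratesSums (A.erase a) B T) (hTT' : T ⊆ T')
    (hab : a + b ∈ T' ∨ a + b ∈ A.erase a + B) : GeneratesSums A B T' := by
  intro x y hxy h0
  have key := hT x y (hxy.mono (Finset.erase_subset _ _) subset_rfl)
    (fun a' ha' b' hb' h => h0 a' (Finset.mem_of_mem_erase ha') b' hb' (hTT' h))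
  intro a₁ ha₁ b₁ hb₁
  by_cases h : a₁ = a
  · subst h
    have hz : x a₁ + y b = 0 := by
      rcases hab with hab | hab
      · exact h0 _ ha₁ _ hb hab
      · obtain ⟨a', ha', b', hb', e⟩ := Finset.mem_add.1 hab
        rw [hxy a₁ ha₁ a' (Finset.mem_of_mem_erase ha') b hb b' hb' e.symm]
        exact key a' ha' b' hb'
    obtain ⟨a', ha'⟩ := hA'
    linarith [key a' ha' b hb, key a' ha' b₁ hb₁]
  · exact key a₁ (Finset.mem_erase.2 ⟨h, ha₁⟩) b₁ hb₁

lemma GeneratesSums.of_erase_right {A B T T' : Finset ℤ} {a b : ℤ} (ha : a ∈ A)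
    (hB' : (B.erase b).Nonempty) (hT : GeneratesSums A (B.erase b) T) (hTT' : T ⊆ T')
    (hab : a + b ∈ T' ∨ a + b ∈ A + B.erase b) : GeneratesSums A B T' := by
  refine (GeneratesSums.of_erase_left ha hB' hT.swap hTT' ?_).swap
  rwa [add_comm b a, add_comm (B.erase b) A]

/-- The sums lost by removing the maximum of `A` and the maximum of `B` generate all sums. -/
lemma generatesSums_sdiff {A B : Finset ℤ} {a b : ℤ} (ha : a ∈ A) (hb : b ∈ B)
    (hamax : ∀ a' ∈ A, a' ≤ a) (hbmax : ∀ b' ∈ B, b' ≤ b) :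
    GeneratesSums A B ((A + B) \ (A.erase a + B.erase b)) := by
  intro x y hxy h0
  have hlt : ∀ a' ∈ A.erase a, a' < a := fun a' h =>
    lt_of_le_of_ne (hamax _ (Finset.mem_of_mem_erase h)) (Finset.ne_of_mem_erase h)
  have hlt' : ∀ b' ∈ B.erase b, b' < b := fun b' h =>
    lt_of_le_of_ne (hbmax _ (Finset.mem_of_mem_erase h)) (Finset.ne_of_mem_erase h)
  have hz : x a + y b = 0 := by
    refine h0 a ha b hb (Finset.mem_sdiff.2 ⟨Finset.add_mem_add ha hb, fun h => ?_⟩)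
    obtain ⟨a', ha', b', hb', e⟩ := Finset.mem_add.1 h
    linarith [hlt a' ha', hlt' b' hb']
  have key : ∀ n : ℕ, (∀ a' ∈ A, (a - a').toNat = n → x a' + y b = 0) ∧
      (∀ b' ∈ B, (b - b').toNat = n → x a + y b' = 0) := by
    intro n
    induction n using Nat.strong_induction_on with
    | _ n ih =>
    have aux : ∀ a₁ ∈ A, ∀ b₁ ∈ B, (a + b - a₁ - b₁).toNat = n → x a₁ + y b₁ = 0 := by
      intro a₁ ha₁ b₁ hb₁ e
      by_cases h : a₁ + b₁ ∈ A.erase a + B.erase b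
      · obtain ⟨a', ha', b', hb', e'⟩ := Finset.mem_add.1 h
        have h1 := hlt a' ha'
        have h2 := hlt' b' hb'
        have ha'' := Finset.mem_of_mem_erase ha'
        have hb'' := Finset.mem_of_mem_erase hb'
        have h3 := (ih (a - a').toNat (by omega)).1 a' ha'' rfl
        have h4 := (ih (b - b').toNat (by omega)).2 b' hb'' rfl
        linarith [hxy a₁ ha₁ a' ha'' b₁ hb₁ b' hb'' e'.symm]
      · exact h0 _ ha₁ _ hb₁ (Finset.mem_sdiff.2 ⟨Finset.add_mem_add ha₁ hb₁, h⟩)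
    exact ⟨fun a' ha' e => aux a' ha' b hb (by rw [← e]; congr 1; ring),
      fun b' hb' e => aux a ha b' hb' (by rw [← e]; congr 1; ring)⟩
  intro a₁ ha₁ b₁ hb₁
  linarith [(key _).1 a₁ ha₁ rfl, (key _).2 b₁ hb₁ rfl]

/-- A generating set that is small compared with the number of sums. -/
def HasSmallGenerators (A B : Finset ℤ) : Prop :=
  ∃ T : Finset ℤ, T ⊆ A + B ∧ GeneratesSums A B T ∧ T.card + 1 ≤ A.card + B.card ∧
    ((T.card : ℤ) - 1) * (A.card * B.card) ≤ ((A + B).card - 1) * (A.card + B.card + 1)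

lemma HasSmallGenerators.swap {A B : Finset ℤ} (h : HasSmallGenerators A B) :
    HasSmallGenerators B A := by
  obtain ⟨T, h1, h2, h3, h4⟩ := h
  refine ⟨T, by rwa [add_comm], h2.swap, by omega, ?_⟩
  rw [add_comm B A]
  linarith

lemma hasSmallGenerators_of_card_eq_one {A B : Finset ℤ} (hA : A.card = 1) (hB : B.Nonempty) :
    HasSmallGenerators A B := by
  have hs : (A + B).card = B.card := by
    obtain ⟨a, rfl⟩ := Finset.card_eq_one.1 hA
    rw [Finset.singleton_add]
    exact Finset.card_image_of_injective _ (add_right_injective a)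
  have := hB.card_pos
  refine ⟨A + B, subset_rfl, generatesSums_add A B, by omega, ?_⟩
  rw [hs, hA]
  push_cast
  nlinarith

lemma hasSmallGenerators_of_disjoint {A B : Finset ℤ} {a : ℤ} (ha : a ∈ A) (hB : B.Nonempty)
    (hA' : (A.erase a).Nonempty) (h : HasSmallGenerators (A.erase a) B)
    (hd : ∀ b ∈ B, a + b ∉ A.erase a + B) : HasSmallGenerators A B := by
  obtain ⟨T, h1, h2, h3, h4⟩ := h
  obtain ⟨b, hb⟩ := hB
  have hc := Finset.card_erase_add_one ha
  have hs : (A.erase a + B).card + B.card ≤ (A + B).card := by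
    have h5 : (B.image (a + ·)).card = B.card :=
      Finset.card_image_of_injective _ (add_right_injective a)
    rw [← h5, ← Finset.card_union_of_disjoint]
    · refine Finset.card_le_card (Finset.union_subset
        (Finset.add_subset_add_right (Finset.erase_subset _ _)) ?_)
      intro z hz
      obtain ⟨b', hb', rfl⟩ := Finset.mem_image.1 hz
      exact Finset.add_mem_add ha hb'
    · rw [Finset.disjoint_right]
      intro z hz
      obtain ⟨b', hb', rfl⟩ := Finset.mem_image.1 hz
      exact hd b' hb'
  have hi : (insert (a + b) T).card ≤ T.card + 1 := Finset.card_insert_le _ _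
  refine ⟨insert (a + b) T, ?_, ?_, by omega, ?_⟩
  · refine Finset.insert_subset (Finset.add_mem_add ha hb)
      (h1.trans (Finset.add_subset_add_right (Finset.erase_subset _ _)))
  · exact GeneratesSums.of_erase_left hb hA' h2 (Finset.subset_insert _ _)
      (Or.inl (Finset.mem_insert_self _ _))
  · have hT := Finset.card_pos.2 (h2.nonempty hA' ⟨b, hb⟩)
    have hB0 := Finset.card_pos.2 ⟨b, hb⟩
    have hA0 := hA'.card_pos
    rw [← hc]
    generalize (A.erase a).card = k at *
    generalize B.card = l at *
    generalize T.card = t at *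
    generalize (A.erase a + B).card = s' at *
    generalize (A + B).card = s at *
    generalize (insert (a + b) T).card = t' at *
    zify at *
    have e1 : ((t' : ℤ) - 1) * ((k + 1) * l) ≤ t * ((k + 1) * l) := by
      gcongr; linarith
    have e2 : ((s' : ℤ) + l - 1) * (k + 1 + l + 1) ≤ (s - 1) * (k + 1 + l + 1) := by
      gcongr
    refine e1.trans (le_trans ?_ e2)
    have e3 : (0 : ℤ) < k + l + 1 := by positivity
    have e4 : (0:ℤ) ≤ (k + l - 1 - t) * (l * (l + 1)) := by
      apply mul_nonneg
      · linarith
      · positivity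
    refine le_of_mul_le_mul_left ?_ e3
    have e5 := mul_le_mul_of_nonneg_left h4 (show (0:ℤ) ≤ k + l + 2 by positivity)
    nlinarith [mul_pos hA0 hB0]

lemma small_generators_step_same {k l t t' g s' s : ℤ} (hk : 1 ≤ k) (hl : 1 ≤ l) (ht : 1 ≤ t)
    (h : (t' - 1) * (k * l) ≤ (s' - 1) * (k + l + 1)) (htt : t ≤ t') (htg : t ≤ g)
    (hs : s' + g ≤ s) :
    (t - 1) * ((k + 1) * (l + 1)) ≤ (s - 1) * (k + 1 + (l + 1) + 1) := by
  have h1 : (t - 1) * (k * l) ≤ (s' - 1) * (k + l + 1) := by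
    refine le_trans ?_ h
    gcongr
  have h2 : (s' + t - 1) * (k + 1 + (l + 1) + 1) ≤ (s - 1) * (k + 1 + (l + 1) + 1) := by
    gcongr
    linarith
  refine le_trans ?_ h2
  have e3 : (0 : ℤ) < k + l + 1 := by linarith
  refine le_of_mul_le_mul_left ?_ e3
  have e5 := mul_le_mul_of_nonneg_left h1 (show (0:ℤ) ≤ k + l + 3 by linarith)
  have e6 : 0 ≤ (t - 1) * (k * l) := by apply mul_nonneg; linarith; positivity
  have e7 : 0 ≤ (t - 1) * (k + l) := by apply mul_nonneg; linarith; linarith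
  nlinarith [mul_le_mul hk hl zero_le_one (by linarith)]

lemma small_generators_step_drop {k l t t' g s' s : ℤ} (hk : 1 ≤ k) (hl : 1 ≤ l)
    (h : (t' - 1) * (k * l) ≤ (s' - 1) * (k + l + 1)) (htt : t ≤ t' + 1)
    (htg : t ≤ g) (hkg : k + 1 ≤ g) (hlg : l + 1 ≤ g) (hs : s' + g ≤ s) :
    (t - 1) * ((k + 1) * (l + 1)) ≤ (s - 1) * (k + 1 + (l + 1) + 1) := by
  have h1 : (t - 2) * (k * l) ≤ (s' - 1) * (k + l + 1) := by
    refine le_trans ?_ h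
    gcongr ?_ * _
    linarith
  have h2 : (s' + g - 1) * (k + 1 + (l + 1) + 1) ≤ (s - 1) * (k + 1 + (l + 1) + 1) := by
    gcongr
  refine le_trans ?_ h2
  have e3 : (0 : ℤ) < k + l + 1 := by linarith
  refine le_of_mul_le_mul_left ?_ e3
  have e5 := mul_le_mul_of_nonneg_left h1 (show (0:ℤ) ≤ k + l + 3 by linarith)
  have e6 : 0 ≤ (g - t) * ((k + l + 3) * (k + l + 1) - 2 * (k + 1) * (l + 1)) := by
    apply mul_nonneg
    · linarith
    · nlinarith
  have e7 : 0 ≤ (2 * g - (k + 1) - (l + 1)) * ((k + 1) * (l + 1)) := by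
    apply mul_nonneg
    · linarith
    · positivity
  nlinarith [mul_le_mul hk hl zero_le_one (by linarith)]

lemma hasSmallGenerators_of_erase_erase {A B : Finset ℤ} {a b : ℤ} (ha : a ∈ A) (hb : b ∈ B)
    (hamax : ∀ a' ∈ A, a' ≤ a) (hbmax : ∀ b' ∈ B, b' ≤ b)
    (hA' : (A.erase a).Nonempty) (hB' : (B.erase b).Nonempty)
    (h : HasSmallGenerators (A.erase a) (B.erase b))
    (h1 : ∃ b₁ ∈ B, a + b₁ ∈ A.erase a + B) (h2 : ∃ a₁ ∈ A, a₁ + b ∈ A + B.erase b) :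
    HasSmallGenerators A B := by
  obtain ⟨T', hT', hgen, hcard, hineq⟩ := h
  obtain ⟨b₁, hb₁, hab₁⟩ := h1
  obtain ⟨a₁, ha₁, hab₁'⟩ := h2
  have hsub : A.erase a + B.erase b ⊆ A + B :=
    Finset.add_subset_add (Finset.erase_subset _ _) (Finset.erase_subset _ _)
  have hW := generatesSums_sdiff ha hb hamax hbmax
  have hWs : (A + B) \ (A.erase a + B.erase b) ⊆ A + B := Finset.sdiff_subset
  have hWc := Finset.card_sdiff_add_card_eq_card hsub
  have hcA := Finset.card_erase_add_one ha
  have hcB := Finset.card_erase_add_one hb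
  have hpA := hA'.card_pos
  have hpB := hB'.card_pos
  set W := (A + B) \ (A.erase a + B.erase b) with hWdef
  -- the smaller of `W` and another generating set
  have smaller : ∀ S ⊆ A + B, GeneratesSums A B S →
      ∃ T ⊆ A + B, GeneratesSums A B T ∧ T.card ≤ S.card ∧ T.card ≤ W.card := by
    intro S hS hSg
    rcases le_total S.card W.card with hle | hle
    · exact ⟨S, hS, hSg, le_rfl, hle⟩
    · exact ⟨W, hWs, hW, hle, le_rfl⟩
  have pos : ∀ T, GeneratesSums A B T → 1 ≤ T.card := fun T hT =>
    (hT.nonempty ⟨a, ha⟩ ⟨b, hb⟩).card_pos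
  by_cases hP : GeneratesSums A B T'
  · obtain ⟨T, hTs, hTg, hT1, hT2⟩ := smaller T' (hT'.trans hsub) hP
    refine ⟨T, hTs, hTg, by omega, ?_⟩
    have hT0 := pos T hTg
    rw [← hcA, ← hcB]
    push_cast
    zify at hpA hpB hT0 hT1 hT2 hWc
    exact small_generators_step_same hpA hpB hT0 hineq hT1 hT2 (by linarith)
  · have hdA : ∀ b' ∈ B, a + b' ∉ A.erase a + B.erase b := by
      intro b' hb' hmem
      by_cases hbb : b' = b
      · obtain ⟨a₂, ha₂, b₂, hb₂, e⟩ := Finset.mem_add.1 hmem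
        have := lt_of_le_of_ne (hamax _ (Finset.mem_of_mem_erase ha₂)) (Finset.ne_of_mem_erase ha₂)
        have := hbmax _ (Finset.mem_of_mem_erase hb₂)
        linarith
      · exact hP ((hgen.of_erase_left (Finset.mem_erase.2 ⟨hbb, hb'⟩) hA' subset_rfl
          (Or.inr hmem)).of_erase_right ha₁ hB' subset_rfl (Or.inr hab₁'))
    have hdB : ∀ a' ∈ A, a' + b ∉ A.erase a + B.erase b := by
      intro a' ha' hmem
      by_cases haa : a' = a
      · subst haa
        exact hdA b hb hmem
      · exact hP ((hgen.of_erase_right (Finset.mem_erase.2 ⟨haa, ha'⟩) hB' subset_rfl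
          (Or.inr hmem)).of_erase_left hb₁ hA' subset_rfl (Or.inr hab₁))
    have hlW : B.card ≤ W.card :=
      Finset.card_le_card_of_injOn (a + ·)
        (fun b' hb' => Finset.mem_sdiff.2 ⟨Finset.add_mem_add ha hb', hdA b' hb'⟩)
        (add_right_injective a).injOn
    have hkW : A.card ≤ W.card :=
      Finset.card_le_card_of_injOn (· + b)
        (fun a' ha' => Finset.mem_sdiff.2 ⟨Finset.add_mem_add ha' hb, hdB a' ha'⟩)
        (add_left_injective b).injOn
    obtain ⟨b₂, hb₂⟩ := id hB'
    obtain ⟨T, hTs, hTg, hT1, hT2⟩ := smaller (insert (a + b₂) T')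
      (Finset.insert_subset (Finset.add_mem_add ha (Finset.mem_of_mem_erase hb₂))
        (hT'.trans hsub))
      ((hgen.of_erase_left hb₂ hA' (Finset.subset_insert _ _)
        (Or.inl (Finset.mem_insert_self _ _))).of_erase_right ha₁ hB' subset_rfl (Or.inr hab₁'))
    have hT3 : T.card ≤ T'.card + 1 := hT1.trans (Finset.card_insert_le _ _)
    refine ⟨T, hTs, hTg, by omega, ?_⟩
    rw [← hcA] at hkW ⊢
    rw [← hcB] at hlW ⊢
    push_cast
    zify at hpA hpB hT3 hT2 hWc hkW hlW
    exact small_generators_step_drop hpA hpB hineq hT3 hT2 hkW hlW (by linarith)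

theorem hasSmallGenerators {A B : Finset ℤ} (hA : A.Nonempty) (hB : B.Nonempty) :
    HasSmallGenerators A B := by
  induction hn : A.card + B.card using Nat.strong_induction_on generalizing A B with
  | _ n ih =>
  by_cases hA1 : A.card = 1
  · exact hasSmallGenerators_of_card_eq_one hA1 hB
  by_cases hB1 : B.card = 1
  · exact (hasSmallGenerators_of_card_eq_one hB1 hA).swap
  have ha := A.max'_mem hA
  have hb := B.max'_mem hB
  set a := A.max' hA
  set b := B.max' hB
  have hcA := Finset.card_erase_add_one ha
  have hcB := Finset.card_erase_add_one hb
  have hA' : (A.erase a).Nonempty := Finset.card_pos.1 (by have := hA.card_pos; omega)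
  have hB' : (B.erase b).Nonempty := Finset.card_pos.1 (by have := hB.card_pos; omega)
  by_cases h1 : ∃ b₁ ∈ B, a + b₁ ∈ A.erase a + B
  · by_cases h2 : ∃ a₁ ∈ A, a₁ + b ∈ A + B.erase b
    · exact hasSmallGenerators_of_erase_erase ha hb (fun _ h => A.le_max' _ h)
        (fun _ h => B.le_max' _ h) hA' hB' (ih _ (by omega) hA' hB' rfl) h1 h2
    · push Not at h2
      refine (hasSmallGenerators_of_disjoint hb hA hB' (ih _ (by omega) hB' hA rfl) ?_).swap
      intro a₁ ha₁
      rw [add_comm b, add_comm (B.erase b)]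
      exact h2 a₁ ha₁
  · push Not at h1
    exact hasSmallGenerators_of_disjoint ha hB hA' (ih _ (by omega) hA' hB rfl) h1

/-- The number of colourings with `q` colours that are constantly `0` on `Y`. -/
lemma card_filter_forall_mem_eq_zero {V : Type*} [Fintype V] [DecidableEq V] (Y : Finset V)
    (q : ℕ) [NeZero q] :
    ((Finset.univ.filter fun f : V → Fin q => ∀ v ∈ Y, f v = 0).card : ℝ) =
      (q : ℝ) ^ Fintype.card V * (1 / q) ^ Y.card := by
  have h : (Finset.univ.filter fun f : V → Fin q => ∀ v ∈ Y, f v = 0) =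
      Fintype.piFinset fun v => if v ∈ Y then {0} else Finset.univ := by
    ext f
    simp only [Finset.mem_filter, Finset.mem_univ, true_and, Fintype.mem_piFinset]
    refine forall_congr' fun v => ?_
    by_cases hv : v ∈ Y <;> simp [hv]
  have hc : ∀ v, (if v ∈ Y then ({0} : Finset (Fin q)) else Finset.univ).card =
      if v ∈ Y then 1 else q := by
    intro v
    split_ifs <;> simp
  have hq : (q : ℝ) ≠ 0 := Nat.cast_ne_zero.2 (NeZero.ne q)
  have hcard : Yᶜ.card + Y.card = Fintype.card V := by
    rw [add_comm]; exact Y.card_add_card_compl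
  rw [h, Fintype.card_piFinset, Finset.prod_congr rfl fun v _ => hc v, Finset.prod_ite,
    Finset.prod_const_one, one_mul, Finset.prod_const, ← hcard, pow_add, mul_assoc, ← mul_pow,
    mul_one_div_cancel hq, one_pow, mul_one, Finset.filter_notMem_eq_sdiff,
    ← Finset.compl_eq_univ_sdiff]
  push_cast
  rfl

/-- The deletion method: a large subset of `G` containing none of the sets `X i`. -/
lemma exists_subset_forall_not_subset {α ι : Type*} [DecidableEq α] (G : Finset α) (P : Finset ι)
    (X : ι → Finset α) (hXG : ∀ i ∈ P, X i ⊆ G) (hX : ∀ i, (X i).Nonempty) {q : ℕ}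
    (hq : 0 < q) :
    ∃ S ⊆ G, (∀ i ∈ P, ¬ X i ⊆ S) ∧
      (G.card : ℝ) / q - ∑ i ∈ P, (1 / q : ℝ) ^ (X i).card ≤ S.card := by
  classical
  have : NeZero q := ⟨hq.ne'⟩
  let Y : ι → Finset G := fun i => (X i).subtype (· ∈ G)
  have hY : ∀ i ∈ P, (Y i).card = (X i).card := fun i hi => by
    rw [Finset.card_subtype, Finset.filter_true_of_mem (hXG i hi)]
  let zeros : (G → Fin q) → Finset G := fun f => Finset.univ.filter fun v => f v = 0
  let bad : (G → Fin q) → Finset ι := fun f => P.filter fun i => ∀ v ∈ Y i, f v = 0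
  obtain ⟨f, -, hf⟩ : ∃ f ∈ (Finset.univ : Finset (G → Fin q)),
      (G.card : ℝ) / q - ∑ i ∈ P, (1 / q : ℝ) ^ (X i).card ≤
        ((zeros f).card : ℝ) - (bad f).card := by
    apply Finset.exists_le_of_sum_le ⟨fun _ => 0, Finset.mem_univ _⟩
    have h1 : ∑ f : G → Fin q, ((zeros f).card : ℝ) = (q : ℝ) ^ G.card * (G.card / q) := by
      simp only [zeros, Finset.card_filter, Nat.cast_sum]
      rw [Finset.sum_comm]
      have : ∀ v : G, ∑ f : G → Fin q, (((if f v = 0 then 1 else 0 : ℕ)) : ℝ) =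
          (q : ℝ) ^ G.card * (1 / q) := by
        intro v
        have := card_filter_forall_mem_eq_zero {v} q
        simp only [Finset.mem_singleton, forall_eq, Finset.card_singleton, pow_one,
          Fintype.card_coe] at this
        rw [← this, Finset.card_filter]
        push_cast
        rfl
      rw [Finset.sum_congr rfl fun v _ => this v]
      simp
      ring
    have h2 : ∑ f : G → Fin q, ((bad f).card : ℝ) =
        (q : ℝ) ^ G.card * ∑ i ∈ P, (1 / q : ℝ) ^ (X i).card := by
      simp only [bad, Finset.card_filter, Nat.cast_sum]
      rw [Finset.sum_comm, Finset.mul_sum]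
      refine Finset.sum_congr rfl fun i hi => ?_
      have := card_filter_forall_mem_eq_zero (Y i) q
      rw [Fintype.card_coe, hY i hi] at this
      rw [← this, Finset.card_filter]
      push_cast
      rfl
    have h3 : ∑ f : G → Fin q, (((zeros f).card : ℝ) - (bad f).card) =
        (q : ℝ) ^ G.card * (G.card / q - ∑ i ∈ P, (1 / q : ℝ) ^ (X i).card) := by
      rw [Finset.sum_sub_distrib, h1, h2, mul_sub]
    rw [h3, Finset.sum_const, nsmul_eq_mul]
    simp
  choose x hx using hX
  refine ⟨(zeros f).map (Function.Embedding.subtype _) \ (bad f).image x, ?_, ?_, ?_⟩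
  · intro v hv
    obtain ⟨w, -, rfl⟩ := Finset.mem_map.1 (Finset.mem_sdiff.1 hv).1
    exact w.2
  · intro i hi hsub
    have hbad : i ∈ bad f := by
      refine Finset.mem_filter.2 ⟨hi, fun v hv => ?_⟩
      obtain ⟨w, hw, e⟩ := Finset.mem_map.1
        (Finset.mem_sdiff.1 (hsub (Finset.mem_subtype.1 hv))).1
      obtain rfl : w = v := Subtype.ext e
      exact (Finset.mem_filter.1 hw).2
    exact (Finset.mem_sdiff.1 (hsub (hx i))).2 (Finset.mem_image_of_mem _ hbad)
  · have h1 := Finset.le_card_sdiff ((bad f).image x)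
      ((zeros f).map (Function.Embedding.subtype (· ∈ G)))
    have h2 : ((bad f).image x).card ≤ (bad f).card := Finset.card_image_le
    rw [Finset.card_map] at h1
    have h3 : (zeros f).card ≤ ((zeros f).map (Function.Embedding.subtype (· ∈ G)) \
      (bad f).image x).card + (bad f).card := by omega
    have h4 : ((zeros f).card : ℝ) ≤ ((zeros f).map (Function.Embedding.subtype (· ∈ G)) \
      (bad f).image x).card + (bad f).card := by exact_mod_cast h3
    linarith

/-- The set of sums of the two components of a pair of tuples. -/
def sumset {k l : ℕ} (p : (Fin k → ℤ) × (Fin l → ℤ)) : Finset ℤ :=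
  Finset.univ.image fun e : Fin k × Fin l => p.1 e.1 + p.2 e.2

lemma sumset_eq_add {k l : ℕ} (p : (Fin k → ℤ) × (Fin l → ℤ)) :
    sumset p = Finset.univ.image p.1 + Finset.univ.image p.2 := by
  ext z
  simp [sumset, Finset.mem_add]

lemma sumset_subset_iff {k l : ℕ} {p : (Fin k → ℤ) × (Fin l → ℤ)} {S : Finset ℤ} :
    sumset p ⊆ S ↔ ∀ i j, p.1 i + p.2 j ∈ S := by
  simp [sumset, Finset.image_subset_iff]

lemma le_card_sumset {k l : ℕ} {p : (Fin k → ℤ) × (Fin l → ℤ)} (hp : Function.Injective p.1)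
    (j : Fin l) : k ≤ (sumset p).card := by
  calc k = (Finset.univ : Finset (Fin k)).card := by simp
    _ ≤ _ := Finset.card_le_card_of_injOn (fun i => p.1 i + p.2 j)
      (fun i _ => Finset.mem_image_of_mem (fun e : Fin k × Fin l => p.1 e.1 + p.2 e.2)
        (Finset.mem_univ (i, j)))
      ((add_left_injective _).comp hp).injOn

/-- The index pairs of coinciding sums. -/
def coincidences {k l : ℕ} (p : (Fin k → ℤ) × (Fin l → ℤ)) :
    Finset ((Fin k × Fin l) × (Fin k × Fin l)) :=
  Finset.univ.filter fun e => p.1 e.1.1 + p.2 e.1.2 = p.1 e.2.1 + p.2 e.2.2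

/-- The sums indexed by `E` generate all sums of the pair `p`, and `E` is small. -/
def IsSmallGeneratingIndex {k l : ℕ} (p : (Fin k → ℤ) × (Fin l → ℤ))
    (E : Finset (Fin k × Fin l)) : Prop :=
  E.Nonempty ∧
    GeneratesSums (Finset.univ.image p.1) (Finset.univ.image p.2)
      (E.image fun e => p.1 e.1 + p.2 e.2) ∧
    ((E.card : ℤ) - 1) * (k * l) ≤ ((sumset p).card - 1) * (k + l + 1)

lemma exists_isSmallGeneratingIndex {k l : ℕ} (hk : 0 < k) (hl : 0 < l)
    {p : (Fin k → ℤ) × (Fin l → ℤ)} (h1 : Function.Injective p.1) (h2 : Function.Injective p.2) :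
    ∃ E, IsSmallGeneratingIndex p E := by
  have : NeZero k := ⟨hk.ne'⟩
  have : NeZero l := ⟨hl.ne'⟩
  have hA : (Finset.univ.image p.1).Nonempty := Finset.univ_nonempty.image _
  have hB : (Finset.univ.image p.2).Nonempty := Finset.univ_nonempty.image _
  obtain ⟨T, hT, hgen, -, hcard⟩ := hasSmallGenerators hA hB
  rw [← sumset_eq_add] at hT hcard
  obtain ⟨E, -, hinj, rfl⟩ := Finset.exists_subset_injOn_image_eq_of_surjOn
    (f := fun e : Fin k × Fin l => p.1 e.1 + p.2 e.2) _ T (Finset.surjOn_iff_subset_image.2 hT)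
  refine ⟨E, Finset.image_nonempty.1 (hgen.nonempty hA hB), hgen, ?_⟩
  rwa [Finset.card_image_of_injOn hinj, Finset.card_image_of_injective _ h1,
    Finset.card_image_of_injective _ h2, Finset.card_fin, Finset.card_fin] at hcard

/-- A pair of tuples is determined by its coincidences, its values on a generating index set, and
one coordinate. -/
lemma eq_of_coincidences_eq {k l : ℕ} {p p' : (Fin k → ℤ) × (Fin l → ℤ)} (hk : 0 < k) {j : Fin l}
    (h1 : Function.Injective p.1) (h2 : Function.Injective p.2) (hj : p.2 j = p'.2 j)
    (hR : coincidences p = coincidences p') {E : Finset (Fin k × Fin l)}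
    (hE : IsSmallGeneratingIndex p E)
    (h : ∀ e ∈ E, p.1 e.1 + p.2 e.2 = p'.1 e.1 + p'.2 e.2) : p = p' := by
  have hR' : ∀ i i' j j', p.1 i + p.2 j = p.1 i' + p.2 j' → p'.1 i + p'.2 j = p'.1 i' + p'.2 j' := by
    intro i i' j j' e
    have : ((i, j), (i', j')) ∈ coincidences p' := hR ▸ Finset.mem_filter.2 ⟨Finset.mem_univ _, e⟩
    exact (Finset.mem_filter.1 this).2
  have key := hE.2.1 (Function.extend p.1 (fun i => p.1 i - p'.1 i) 0)
    (Function.extend p.2 (fun i => p.2 i - p'.2 i) 0)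
  simp only [RespectsSums, Finset.mem_image, Finset.mem_univ, true_and, forall_exists_index,
    forall_apply_eq_imp_iff, h1.extend_apply, h2.extend_apply] at key
  have hz : ∀ i j, p.1 i - p'.1 i + (p.2 j - p'.2 j) = 0 := by
    refine key ?_ ?_
    · intro i i' j j' e
      linarith [hR' i i' j j' e]
    · rintro i j e ⟨he, e1⟩
      linarith [hR' _ _ _ _ e1, h e he]
  have ha : ∀ i, p.1 i = p'.1 i := fun i => by linarith [hz i j]
  refine Prod.ext (funext ha) (funext fun j' => ?_)
  linarith [hz ⟨0, hk⟩ j', ha ⟨0, hk⟩]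

/-- The pairs of injective tuples all of whose sums lie in `[0, M)`, the second one vanishing at
`j`. -/
noncomputable def rectangles (M k : ℕ) {l : ℕ} (j : Fin l) : Finset ((Fin k → ℤ) × (Fin l → ℤ)) :=
  open Classical in
  ((Fintype.piFinset fun _ => Finset.Ico (-M : ℤ) M) ×ˢ
    (Fintype.piFinset fun _ => Finset.Ico (-M : ℤ) M)).filter fun p =>
      Function.Injective p.1 ∧ Function.Injective p.2 ∧ p.2 j = 0 ∧
        sumset p ⊆ Finset.Ico (0 : ℤ) M

lemma mem_rectangles {M k l : ℕ} (hk : 0 < k) {j : Fin l} {p : (Fin k → ℤ) × (Fin l → ℤ)} :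
    p ∈ rectangles M k j ↔ Function.Injective p.1 ∧ Function.Injective p.2 ∧ p.2 j = 0 ∧
      sumset p ⊆ Finset.Ico (0 : ℤ) M := by
  rw [rectangles, Finset.mem_filter, and_iff_right_iff_imp]
  rintro ⟨-, -, hj, hs⟩
  rw [sumset_subset_iff] at hs
  simp only [Finset.mem_product, Fintype.mem_piFinset, Finset.mem_Ico] at hs ⊢
  have ha : ∀ i, 0 ≤ p.1 i ∧ p.1 i < M := fun i => by simpa [hj] using hs i j
  refine ⟨fun i => ⟨?_, (ha i).2⟩, fun j' => ?_⟩
  · linarith [(ha i).1, Int.natCast_nonneg M]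
  · have := hs ⟨0, hk⟩ j'
    have := ha ⟨0, hk⟩
    constructor <;> linarith

lemma card_filter_rectangles_le {M k l : ℕ} (hk : 0 < k) (j : Fin l)
    (R : Finset ((Fin k × Fin l) × (Fin k × Fin l))) (E : Finset (Fin k × Fin l))
    (Q : Finset ((Fin k → ℤ) × (Fin l → ℤ)))
    (hQ : ∀ p ∈ Q, p ∈ rectangles M k j ∧ coincidences p = R ∧ IsSmallGeneratingIndex p E) :
    Q.card ≤ M ^ E.card := by
  have hc : (Fintype.piFinset fun _ : E => Finset.Ico (0 : ℤ) M).card = M ^ E.card := by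
    simp
  rw [← hc]
  refine Finset.card_le_card_of_injOn (fun p e => p.1 e.1.1 + p.2 e.1.2) ?_ ?_
  · intro p hp
    have := ((mem_rectangles hk).1 (hQ p hp).1).2.2.2
    rw [sumset_subset_iff] at this
    exact Fintype.mem_piFinset.2 fun e => this _ _
  · intro p hp p' hp' e
    obtain ⟨hr, hR, hE⟩ := hQ p hp
    obtain ⟨hr', hR', hE'⟩ := hQ p' hp'
    obtain ⟨h1, h2, h3, -⟩ := (mem_rectangles hk).1 hr
    obtain ⟨-, -, h3', -⟩ := (mem_rectangles hk).1 hr'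
    exact eq_of_coincidences_eq hk h1 h2 (h3.trans h3'.symm) (hR.trans hR'.symm) hE
      fun e' he' => congrFun e ⟨e', he'⟩

lemma pow_mul_pow_le {k l s t M N q : ℕ} (hk : 0 < k) (hl : 0 < l) (hs : 2 ≤ s) (ht : 1 ≤ t)
    (h : ((t : ℤ) - 1) * (k * l) ≤ (s - 1) * (k + l + 1)) (hN : 1 ≤ N) (hMN : M ≤ N) (hq : 0 < q)
    (hqN : (N : ℝ) ^ (((k : ℝ) + l + 2) / (k * l)) ≤ q) :
    (M : ℝ) ^ t * (1 / q) ^ s ≤ M / q * (N : ℝ) ^ (-(1 / (k * l) : ℝ)) := by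
  obtain ⟨s, rfl⟩ := Nat.exists_eq_add_of_le' (show 1 ≤ s by omega)
  obtain ⟨t, rfl⟩ := Nat.exists_eq_add_of_le' ht
  have hN0 : (0 : ℝ) < N := by exact_mod_cast hN
  have hq0 : (0 : ℝ) < q := by exact_mod_cast hq
  have hkl : (0 : ℝ) < (k : ℝ) * l := by positivity
  have h' : (t : ℝ) * (k * l) ≤ s * (k + l + 1) := by
    push_cast at h
    simp only [add_sub_cancel_right] at h
    exact_mod_cast h
  have hs' : (1 : ℝ) ≤ s := by exact_mod_cast (show 1 ≤ s by omega)
  have key : (M : ℝ) ^ t ≤ (N : ℝ) ^ (-(1 / (k * l) : ℝ)) * (q : ℝ) ^ s := by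
    calc (M : ℝ) ^ t ≤ (N : ℝ) ^ t := by gcongr
      _ = (N : ℝ) ^ (t : ℝ) := (Real.rpow_natCast _ _).symm
      _ ≤ (N : ℝ) ^ (-(1 / (k * l) : ℝ) + ((k : ℝ) + l + 2) / (k * l) * s) := by
        apply Real.rpow_le_rpow_of_exponent_le (by exact_mod_cast hN)
        rw [← mul_le_mul_iff_left₀ hkl]
        field_simp
        linarith
      _ = (N : ℝ) ^ (-(1 / (k * l) : ℝ)) * ((N : ℝ) ^ (((k : ℝ) + l + 2) / (k * l))) ^ s := by
        rw [Real.rpow_add hN0, Real.rpow_mul_natCast hN0.le]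
      _ ≤ _ := by gcongr
  calc (M : ℝ) ^ (t + 1) * (1 / q) ^ (s + 1) = (M : ℝ) ^ t * (M / q * (1 / q) ^ s) := by ring
    _ ≤ (N : ℝ) ^ (-(1 / (k * l) : ℝ)) * (q : ℝ) ^ s * (M / q * (1 / q) ^ s) := by gcongr
    _ = _ := by
      rw [one_div_pow]
      field_simp

lemma sum_rectangles_le {M N k l q : ℕ} (hk : 2 ≤ k) (hl : 0 < l) (j : Fin l) (hN : 1 ≤ N)
    (hMN : M ≤ N) (hq : 0 < q) (hqN : (N : ℝ) ^ (((k : ℝ) + l + 2) / (k * l)) ≤ q) :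
    ∑ p ∈ rectangles M k j, (1 / q : ℝ) ^ (sumset p).card ≤
      Fintype.card (Finset ((Fin k × Fin l) × (Fin k × Fin l)) × Finset (Fin k × Fin l)) *
        (M / q * (N : ℝ) ^ (-(1 / (k * l) : ℝ))) := by
  classical
  have hk0 : 0 < k := by omega
  have hE : ∀ p, ∃ E, p ∈ rectangles M k j → IsSmallGeneratingIndex p E := by
    intro p
    by_cases hp : p ∈ rectangles M k j
    · obtain ⟨h1, h2, -⟩ := (mem_rectangles hk0).1 hp
      obtain ⟨E, hE⟩ := exists_isSmallGeneratingIndex hk0 hl h1 h2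
      exact ⟨E, fun _ => hE⟩
    · exact ⟨∅, fun h => absurd h hp⟩
  choose E hE using hE
  rw [← Finset.sum_fiberwise _ (fun p => (coincidences p, E p)), ← Finset.card_univ,
    ← nsmul_eq_mul]
  refine Finset.sum_le_card_nsmul _ _ _ ?_
  rintro ⟨R, E₀⟩ -
  set Q := (rectangles M k j).filter fun p => (coincidences p, E p) = (R, E₀) with hQdef
  have hQ : ∀ p ∈ Q, p ∈ rectangles M k j ∧ coincidences p = R ∧ IsSmallGeneratingIndex p E₀ := by
    intro p hp
    obtain ⟨hp, e⟩ := Finset.mem_filter.1 hp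
    obtain ⟨e1, e2⟩ := Prod.mk.inj e
    exact ⟨hp, e1, e2 ▸ hE p hp⟩
  set B := (M : ℝ) / q * (N : ℝ) ^ (-(1 / (k * l) : ℝ))
  have hB : 0 ≤ B := by positivity
  have hcard : (Q.card : ℝ) ≤ (M : ℝ) ^ E₀.card := by
    exact_mod_cast card_filter_rectangles_le hk0 j R E₀ Q hQ
  rcases Q.eq_empty_or_nonempty with h0 | ⟨p₀, hp₀⟩
  · rw [h0]; simpa using hB
  have hpos : 0 < (M : ℝ) ^ E₀.card := by
    refine lt_of_lt_of_le ?_ hcard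
    exact_mod_cast Finset.card_pos.2 ⟨p₀, hp₀⟩
  calc ∑ p ∈ Q, (1 / q : ℝ) ^ (sumset p).card ≤ ∑ p ∈ Q, B / (M : ℝ) ^ E₀.card := by
        refine Finset.sum_le_sum fun p hp => ?_
        obtain ⟨hr, -, hne, -, hineq⟩ := hQ p hp
        rw [le_div_iff₀ hpos, mul_comm]
        exact pow_mul_pow_le hk0 hl
          (hk.trans (le_card_sumset ((mem_rectangles hk0).1 hr).1 j)) hne.card_pos hineq hN hMN hq
          hqN
    _ = Q.card * (B / (M : ℝ) ^ E₀.card) := by rw [Finset.sum_const, nsmul_eq_mul]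
    _ ≤ (M : ℝ) ^ E₀.card * (B / (M : ℝ) ^ E₀.card) := by gcongr
    _ = B := by field_simp

/-- An all-ones submatrix of the circulant matrix of a set `S ⊆ [0, M)` with `2 * M ≤ N` unwraps to
a rectangle of integers. -/
lemma exists_rectangle_of_circulant {N M k l : ℕ} (hk : 0 < k) (hMN : 2 * M ≤ N) (j₀ : Fin l)
    {S : Finset ℤ} (hS : S ⊆ Finset.Ico (0 : ℤ) M) {a : Fin k → Fin N} {b : Fin l → Fin N}
    (ha : Function.Injective a) (hb : Function.Injective b)
    (h : ∀ i j, ((((a i : ℕ) + (b j : ℕ)) % N : ℕ) : ℤ) ∈ S) :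
    ∃ p ∈ rectangles M k j₀, sumset p ⊆ S := by
  let i₀ : Fin k := ⟨0, hk⟩
  let r : Fin k → Fin l → ℤ := fun i j => (((a i : ℕ) + (b j : ℕ)) % N : ℕ)
  have hr : ∀ i j, 0 ≤ r i j ∧ r i j < M := fun i j => Finset.mem_Ico.1 (hS (h i j))
  have hmod : ∀ i j, (N : ℤ) ∣ (a i : ℕ) + (b j : ℕ) - r i j := by
    intro i j
    simp only [r]
    push_cast
    exact Int.dvd_self_sub_emod
  have hdvd : ∀ z : ℤ, (N : ℤ) ∣ z → -N < z → z < N → z = 0 := fun z hz h1 h2 =>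
    Int.eq_zero_of_abs_lt_dvd hz (abs_lt.2 ⟨h1, h2⟩)
  have hsum : ∀ i j, r i j₀ + (r i₀ j - r i₀ j₀) = r i j := by
    intro i j
    have h0 := hdvd (r i j₀ + (r i₀ j - r i₀ j₀) - r i j) (by
      obtain ⟨u, hu⟩ := dvd_sub (dvd_add (hmod i j) (hmod i₀ j₀)) (dvd_add (hmod i j₀) (hmod i₀ j))
      exact ⟨u, by linarith⟩) ?_ ?_
    · linarith
    all_goals
      have := hr i j
      have := hr i j₀
      have := hr i₀ j
      have := hr i₀ j₀
      omega
  refine ⟨(fun i => r i j₀, fun j => r i₀ j - r i₀ j₀), ?_, ?_⟩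
  · refine (mem_rectangles hk).2 ⟨?_, ?_, sub_self _, ?_⟩
    · intro i i' e
      simp only at e
      apply ha
      have := hdvd ((a i : ℕ) - (a i' : ℕ)) (by
        obtain ⟨u, hu⟩ := dvd_sub (hmod i j₀) (hmod i' j₀)
        exact ⟨u, by linarith⟩) (by omega) (by omega)
      ext
      omega
    · intro j j' e
      simp only [sub_left_inj] at e
      apply hb
      have := hdvd ((b j : ℕ) - (b j' : ℕ)) (by
        obtain ⟨u, hu⟩ := dvd_sub (hmod i₀ j) (hmod i₀ j')
        exact ⟨u, by linarith⟩) (by omega) (by omega)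
      ext
      omega
    · rw [sumset_subset_iff]
      intro i j
      simp only [hsum]
      exact hS (h i j)
  · rw [sumset_subset_iff]
    intro i j
    simp only [hsum]
    exact h i j

lemma mul_card_le_card_circulant {N M : ℕ} (hMN : M ≤ N) {S : Finset ℤ}
    (hS : S ⊆ Finset.Ico (0 : ℤ) M) :
    N * S.card ≤ (Finset.univ.filter fun p : Fin N × Fin N =>
      ((((p.1 : ℕ) + (p.2 : ℕ)) % N : ℕ) : ℤ) ∈ S).card := by
  have hadd : ∀ i : Fin N, ∀ s ∈ S,
      (((i : ℕ) + (s.toNat + (N - i)) % N : ℕ) % N : ℕ) = s.toNat := by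
    intro i s hs
    have := Finset.mem_Ico.1 (hS hs)
    rw [Nat.add_mod_mod, show (i : ℕ) + (s.toNat + (N - i)) = s.toNat + N by omega,
      Nat.add_mod_right, Nat.mod_eq_of_lt (by omega)]
  have hc : N * S.card = ((Finset.univ : Finset (Fin N)) ×ˢ S).card := by simp
  rw [hc]
  refine Finset.card_le_card_of_injOn
    (fun x => (x.1, ⟨(x.2.toNat + (N - x.1)) % N, Nat.mod_lt _ x.1.pos⟩)) ?_ ?_
  · rintro ⟨i, s⟩ hx
    obtain ⟨-, hs⟩ := Finset.mem_product.1 hx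
    have h0 := (Finset.mem_Ico.1 (hS hs)).1
    refine Finset.mem_filter.2 ⟨Finset.mem_univ _, ?_⟩
    simp only [hadd i s hs, Int.toNat_of_nonneg h0]
    exact hs
  · rintro ⟨i, s⟩ hx ⟨i', s'⟩ hx' e
    obtain ⟨-, hs⟩ := Finset.mem_product.1 hx
    obtain ⟨-, hs'⟩ := Finset.mem_product.1 hx'
    simp only [Prod.mk.injEq, Fin.mk.injEq] at e
    obtain ⟨rfl, e⟩ := e
    have h1 := hadd i s hs
    rw [e, hadd i s' hs'] at h1
    have h0 := (Finset.mem_Ico.1 (hS hs)).1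
    have h0' := (Finset.mem_Ico.1 (hS hs')).1
    simp only [Prod.mk.injEq, true_and]
    simp only at h0 h0' h1
    omega

/-- Main theorem: there is a constant `c₀ > 0` such that for all `2 ≤ k ≤ l` and all
sufficiently large `N` there is a circulant `N × N` Boolean matrix
`M i j = c ((i + j) mod N)` that is `(k,l)`-free (contains no all-ones `k × l`
submatrix) and has weight at least `c₀ · ((k+l)/(k²l²)) · N^(2 - (k+l+2)/(kl))`. -/
theorem exists_thin_circulant :
    ∃ c₀ : ℝ, 0 < c₀ ∧ ∀ k l : ℕ, 2 ≤ k → k ≤ l →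
      ∃ N₀ : ℕ, ∀ N : ℕ, N₀ ≤ N →
        ∃ c : ℕ → Bool,
          (¬ ∃ (a : Fin k → Fin N) (b : Fin l → Fin N),
              Function.Injective a ∧ Function.Injective b ∧
              ∀ i j, c (((a i : ℕ) + (b j : ℕ)) % N) = true) ∧
          c₀ * (((k : ℝ) + l) / ((k : ℝ) ^ 2 * (l : ℝ) ^ 2)) *
              (N : ℝ) ^ ((2 : ℝ) - ((k : ℝ) + l + 2) / ((k : ℝ) * l)) ≤
            ((Finset.univ.filter
              (fun p : Fin N × Fin N => c (((p.1 : ℕ) + (p.2 : ℕ)) % N) = true)).card : ℝ) := by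
  refine ⟨1 / 16, by norm_num, fun k l hk hkl => ?_⟩
  have hk0 : 0 < k := by omega
  have hl0 : 0 < l := by omega
  let j₀ : Fin l := ⟨0, hl0⟩
  set C : ℝ := ((Fintype.card
    (Finset ((Fin k × Fin l) × (Fin k × Fin l)) × Finset (Fin k × Fin l)) : ℕ) : ℝ) with hC
  have hlim : Filter.Tendsto (fun N : ℕ => C * (N : ℝ) ^ (-(1 / (k * l) : ℝ))) Filter.atTop
      (nhds 0) := by
    have hpos : (0 : ℝ) < 1 / (k * l) := by positivity
    simpa using ((tendsto_rpow_neg_atTop hpos).comp tendsto_natCast_atTop_atTop).const_mul C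
  obtain ⟨N₁, hN₁⟩ := Filter.eventually_atTop.1 (hlim.eventually_le_const (one_half_pos (α := ℝ)))
  refine ⟨max N₁ 2, fun N hN => ?_⟩
  have hN2 : 2 ≤ N := (le_max_right _ _).trans hN
  have hη := hN₁ N ((le_max_left _ _).trans hN)
  set γ : ℝ := ((k : ℝ) + l + 2) / (k * l) with hγ
  have hN1 : (1 : ℝ) ≤ N := by exact_mod_cast (by omega : 1 ≤ N)
  have hN0 : (0 : ℝ) < N := by linarith
  have hγ1 : 1 ≤ (N : ℝ) ^ γ := Real.one_le_rpow hN1 (by positivity)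
  set q := ⌈(N : ℝ) ^ γ⌉₊ with hqdef
  have hqN : (N : ℝ) ^ γ ≤ q := Nat.le_ceil _
  have hq2 : (q : ℝ) ≤ 2 * (N : ℝ) ^ γ := by
    linarith [Nat.ceil_lt_add_one (show 0 ≤ (N : ℝ) ^ γ by linarith)]
  have hq0 : 0 < q := Nat.ceil_pos.2 (by linarith)
  have hq0' : (0 : ℝ) < q := by exact_mod_cast hq0
  obtain ⟨M, hM⟩ : ∃ M, M = N / 2 := ⟨_, rfl⟩
  have hMN : 2 * M ≤ N := by omega
  have hM4 : (N : ℝ) ≤ 4 * M := by exact_mod_cast (by omega : N ≤ 4 * M)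
  have hsumset : ∀ p : (Fin k → ℤ) × (Fin l → ℤ), (sumset p).Nonempty := fun p =>
    ⟨_, Finset.mem_image_of_mem _ (Finset.mem_univ (⟨0, hk0⟩, j₀))⟩
  obtain ⟨S, hSM, hS, hcard⟩ := exists_subset_forall_not_subset (Finset.Ico (0 : ℤ) M)
    (rectangles M k j₀) sumset (fun p hp => ((mem_rectangles hk0).1 hp).2.2.2) hsumset hq0
  have hsum := sum_rectangles_le (M := M) (N := N) hk hl0 j₀ (by omega) (by omega) hq0 hqN
  rw [← hC] at hsum
  have hScard : (N : ℝ) / (16 * (N : ℝ) ^ γ) ≤ S.card := by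
    have h1 : C * ((M : ℝ) / q * (N : ℝ) ^ (-(1 / (k * l) : ℝ))) ≤ M / q * (1 / 2) := by
      calc _ = (M : ℝ) / q * (C * (N : ℝ) ^ (-(1 / (k * l) : ℝ))) := by ring
        _ ≤ _ := by gcongr
    have h2 : (M : ℝ) / q * (1 / 2) ≤ S.card := by
      simp only [Int.card_Ico, sub_zero, Int.toNat_natCast] at hcard
      linarith
    refine le_trans ?_ h2
    calc (N : ℝ) / (16 * (N : ℝ) ^ γ) ≤ (4 * M) / (16 * (N : ℝ) ^ γ) := by gcongr
      _ = M / (2 * (N : ℝ) ^ γ) * (1 / 2) := by ring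
      _ ≤ _ := by gcongr
  refine ⟨fun n => decide ((n : ℤ) ∈ S), ?_, ?_⟩
  · rintro ⟨a, b, ha, hb, hab⟩
    obtain ⟨p, hp, hpS⟩ := exists_rectangle_of_circulant hk0 hMN j₀ hSM ha hb
      fun i j => of_decide_eq_true (hab i j)
    exact hS p hp hpS
  · have hweight := mul_card_le_card_circulant (by omega : M ≤ N) hSM
    have hfrac : ((k : ℝ) + l) / ((k : ℝ) ^ 2 * (l : ℝ) ^ 2) ≤ 1 := by
      have hk2 : (2 : ℝ) ≤ k := by exact_mod_cast hk
      have hl' : (2 : ℝ) ≤ l := by exact_mod_cast hk.trans hkl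
      rw [div_le_one (by positivity)]
      nlinarith [mul_nonneg (sub_nonneg.2 hk2) (sub_nonneg.2 hl')]
    simp only [decide_eq_true_eq]
    calc _ ≤ 1 / 16 * 1 * (N : ℝ) ^ (2 - γ) := by gcongr
      _ = N * (N / (16 * (N : ℝ) ^ γ)) := by
        rw [Real.rpow_sub hN0, Real.rpow_two]
        field_simp
      _ ≤ N * S.card := by gcongr
      _ ≤ _ := by exact_mod_cast hweight
end

section
/- There exist constants $c_0 > 0$ and $N_0$ such that for every $N \geq N_0$, setting $k = \lceil \log_2 N \rceil$, there is a circulant $N \times N$ Boolean matrix that is $(k,k)$-free and has weight at least $c_0 \cdot \frac{N^2}{(\log_2 N)^3}$. -/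
section Sumset

open scoped Pointwise

variable {W : Type*} [AddCommGroup W] [Module ℚ W]

/-- The span of all differences inside `A` and inside `B`. -/
def differenceSpan (A B : Finset W) : Submodule ℚ W :=
  vectorSpan ℚ (A : Set W) ⊔ vectorSpan ℚ (B : Set W)

lemma differenceSpan_comm (A B : Finset W) : differenceSpan A B = differenceSpan B A :=
  sup_comm _ _

lemma differenceSpan_le_iff {A B : Finset W} {u v : W} (hu : u ∈ A) (hv : v ∈ B)
    (S : Submodule ℚ W) :
    differenceSpan A B ≤ S ↔ (∀ a ∈ A, a - u ∈ S) ∧ ∀ b ∈ B, b - v ∈ S := by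
  rw [differenceSpan, sup_le_iff, vectorSpan_eq_span_vsub_set_right ℚ (Finset.mem_coe.2 hu),
    vectorSpan_eq_span_vsub_set_right ℚ (Finset.mem_coe.2 hv), Submodule.span_le,
    Submodule.span_le]
  simp [Set.subset_def]

lemma sub_mem_differenceSpan_left {A B : Finset W} {a a' : W} (ha : a ∈ A) (ha' : a' ∈ A) :
    a - a' ∈ differenceSpan A B :=
  Submodule.mem_sup_left (vsub_mem_vectorSpan ℚ (Finset.mem_coe.2 ha) (Finset.mem_coe.2 ha'))

lemma sub_mem_differenceSpan_right {A B : Finset W} {b b' : W} (hb : b ∈ B) (hb' : b' ∈ B) :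
    b - b' ∈ differenceSpan A B :=
  Submodule.mem_sup_right (vsub_mem_vectorSpan ℚ (Finset.mem_coe.2 hb) (Finset.mem_coe.2 hb'))

lemma finrank_le_card_of_le_span {S : Submodule ℚ W} {T : Finset W}
    (h : S ≤ Submodule.span ℚ (T : Set W)) : Module.finrank ℚ S ≤ T.card :=
  (Submodule.finrank_mono h).trans (finrank_span_finset_le_card T)

variable [DecidableEq W]

lemma finrank_differenceSpan_add_two_le {A B : Finset W} (hA : A.Nonempty) (hB : B.Nonempty) :
    Module.finrank ℚ (differenceSpan A B) + 2 ≤ A.card + B.card := by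
  obtain ⟨u, hu⟩ := hA
  obtain ⟨v, hv⟩ := hB
  have h : differenceSpan A B ≤ Submodule.span ℚ
      (((A.erase u).image (· - u) ∪ (B.erase v).image (· - v) : Finset W) : Set W) := by
    rw [differenceSpan_le_iff hu hv]
    constructor
    · intro a ha
      by_cases h : a = u
      · simp [h]
      · exact Submodule.subset_span (by
          simp only [Finset.coe_union, Finset.coe_image, Set.mem_union, Set.mem_image]
          exact Or.inl ⟨a, by simp [h, ha], rfl⟩)
    · intro b hb
      by_cases h : b = v
      · simp [h]
      · exact Submodule.subset_span (by
          simp only [Finset.coe_union, Finset.coe_image, Set.mem_union, Set.mem_image]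
          exact Or.inr ⟨b, by simp [h, hb], rfl⟩)
  have h1 := finrank_le_card_of_le_span h
  have h2 := Finset.card_union_le ((A.erase u).image (· - u)) ((B.erase v).image (· - v))
  have h3 : ((A.erase u).image (· - u)).card ≤ _ := Finset.card_image_le
  have h4 : ((B.erase v).image (· - v)).card ≤ _ := Finset.card_image_le
  rw [Finset.card_erase_of_mem hu] at h3
  rw [Finset.card_erase_of_mem hv] at h4
  have := Finset.card_pos.2 ⟨u, hu⟩
  have := Finset.card_pos.2 ⟨v, hv⟩
  omega

/-- Removing the minimal elements of `A` and `B` for a functional destroys more sums than the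
dimension of the differences. -/
lemma finrank_differenceSpan_lt_card_sdiff (φ : W →ₗ[ℚ] ℚ) {A B : Finset W} {u v : W}
    (hu : u ∈ A) (hv : v ∈ B) (hminA : ∀ a ∈ A.erase u, φ u < φ a)
    (hminB : ∀ b ∈ B.erase v, φ v < φ b) :
    Module.finrank ℚ (differenceSpan A B) <
      ((A + B) \ (A.erase u + B.erase v)).card := by
  set L := (A + B) \ (A.erase u + B.erase v) with hL
  set T := (L.erase (u + v)).image (· - (u + v)) with hT
  have huv : u + v ∈ L := by
    rw [hL, Finset.mem_sdiff]
    refine ⟨Finset.add_mem_add hu hv, fun h => ?_⟩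
    obtain ⟨a, ha, b, hb, hab⟩ := Finset.mem_add.1 h
    have := congrArg φ hab
    rw [map_add, map_add] at this
    linarith [hminA a ha, hminB b hb]
  set P := A.image (· - u) ∪ B.image (· - v) with hP
  have hPsum : ∀ x ∈ P, u + v + x ∈ A + B := by
    intro x hx
    rw [hP, Finset.mem_union, Finset.mem_image, Finset.mem_image] at hx
    rcases hx with ⟨a, ha, rfl⟩ | ⟨b, hb, rfl⟩
    · convert Finset.add_mem_add ha hv using 1; abel
    · convert Finset.add_mem_add hu hb using 1; abel
  have hPspan : ∀ x ∈ P, x ∈ Submodule.span ℚ (T : Set W) := by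
    classical
    by_contra! hne
    obtain ⟨x, hx, hmin⟩ := Finset.exists_min_image
      (P.filter fun x => x ∉ Submodule.span ℚ (T : Set W)) φ (by
        obtain ⟨x, hx, hx'⟩ := hne
        exact ⟨x, Finset.mem_filter.2 ⟨hx, hx'⟩⟩)
    obtain ⟨hxP, hxs⟩ := Finset.mem_filter.1 hx
    have hx0 : x ≠ 0 := fun h => hxs (h ▸ zero_mem _)
    by_cases hxL : u + v + x ∈ L
    · refine hxs (Submodule.subset_span (Finset.mem_coe.2 (Finset.mem_image.2
        ⟨u + v + x, Finset.mem_erase.2 ⟨by simpa using hx0, hxL⟩, by abel⟩)))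
    · have hmem : u + v + x ∈ A.erase u + B.erase v := by
        by_contra h
        exact hxL (Finset.mem_sdiff.2 ⟨hPsum x hxP, h⟩)
      obtain ⟨a, ha, b, hb, hab⟩ := Finset.mem_add.1 hmem
      have hxe : x = (a - u) + (b - v) := by
        rw [← sub_eq_iff_eq_add'.2 hab.symm]; abel
      have hφ : φ x = (φ a - φ u) + (φ b - φ v) := by rw [hxe]; simp
      have hlt1 := hminA a ha
      have hlt2 := hminB b hb
      refine hxs (hxe ▸ add_mem ?_ ?_)
      · by_contra h
        have := hmin (a - u) (Finset.mem_filter.2 ⟨Finset.mem_union_left _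
          (Finset.mem_image_of_mem _ (Finset.mem_of_mem_erase ha)), h⟩)
        rw [map_sub] at this
        linarith
      · by_contra h
        have := hmin (b - v) (Finset.mem_filter.2 ⟨Finset.mem_union_right _
          (Finset.mem_image_of_mem _ (Finset.mem_of_mem_erase hb)), h⟩)
        rw [map_sub] at this
        linarith
  have hle : differenceSpan A B ≤ Submodule.span ℚ (T : Set W) :=
    (differenceSpan_le_iff hu hv _).2
      ⟨fun a ha => hPspan _ (Finset.mem_union_left _ (Finset.mem_image_of_mem _ ha)),
        fun b hb => hPspan _ (Finset.mem_union_right _ (Finset.mem_image_of_mem _ hb))⟩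
  calc Module.finrank ℚ (differenceSpan A B) ≤ T.card := finrank_le_card_of_le_span hle
    _ ≤ (L.erase (u + v)).card := Finset.card_image_le
    _ < L.card := Finset.card_erase_lt_of_mem huv

lemma card_le_card_sdiff_of_sub_notMem {A B : Finset W} {u v a₀ : W} (hu : u ∈ A)
    (ha₀ : a₀ ∈ A.erase u) (huv : u + v ∉ A.erase u + B.erase v)
    (h : u - a₀ ∉ differenceSpan (A.erase u) (B.erase v)) :
    B.card ≤ ((A + B) \ (A.erase u + B.erase v)).card := by
  rw [← Finset.card_image_of_injective B (add_right_injective u)]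
  refine Finset.card_le_card fun y hy => ?_
  obtain ⟨b, hb, rfl⟩ := Finset.mem_image.1 hy
  refine Finset.mem_sdiff.2 ⟨Finset.add_mem_add hu hb, fun hmem => ?_⟩
  by_cases hbv : b = v
  · exact huv (hbv ▸ hmem)
  obtain ⟨a', ha', b', hb', hab⟩ := Finset.mem_add.1 hmem
  refine h ?_
  have e : u - a₀ = (b' - b) + (a' - a₀) := by
    have : u = a' + b' - b := by rw [hab]; abel
    rw [this]; abel
  rw [e]
  exact add_mem (sub_mem_differenceSpan_right hb' (Finset.mem_erase.2 ⟨hbv, hb⟩))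
    (sub_mem_differenceSpan_left ha' ha₀)

/-- A Freiman-type lower bound for the size of a sumset of large dimension. -/
lemma card_mul_finrank_differenceSpan_le (φ : W →ₗ[ℚ] ℚ) (n : ℕ) :
    ∀ A B : Finset W, A.card = n → B.card = n → Set.InjOn φ A → Set.InjOn φ B →
      n * (Module.finrank ℚ (differenceSpan A B) + 1) ≤ 4 * (A + B).card := by
  induction n with
  | zero => simp
  | succ n ih =>
    intro A B hA hB hφA hφB
    have hAne : A.Nonempty := Finset.card_pos.1 (by omega)
    have hBne : B.Nonempty := Finset.card_pos.1 (by omega)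
    obtain ⟨u, hu, humin⟩ := Finset.exists_min_image A φ hAne
    obtain ⟨v, hv, hvmin⟩ := Finset.exists_min_image B φ hBne
    have hminA : ∀ a ∈ A.erase u, φ u < φ a := fun a ha =>
      lt_of_le_of_ne (humin a (Finset.mem_of_mem_erase ha)) fun h =>
        Finset.ne_of_mem_erase ha (hφA (Finset.mem_of_mem_erase ha) hu h.symm)
    have hminB : ∀ b ∈ B.erase v, φ v < φ b := fun b hb =>
      lt_of_le_of_ne (hvmin b (Finset.mem_of_mem_erase hb)) fun h =>
        Finset.ne_of_mem_erase hb (hφB (Finset.mem_of_mem_erase hb) hv h.symm)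
    have hA' : (A.erase u).card = n := by rw [Finset.card_erase_of_mem hu]; omega
    have hB' : (B.erase v).card = n := by rw [Finset.card_erase_of_mem hv]; omega
    have hrec := ih (A.erase u) (B.erase v) hA' hB'
      (hφA.mono (by simp)) (hφB.mono (by simp))
    have hlost := finrank_differenceSpan_lt_card_sdiff φ hu hv hminA hminB
    have hsub : A.erase u + B.erase v ⊆ A + B :=
      Finset.add_subset_add (Finset.erase_subset _ _) (Finset.erase_subset _ _)
    have hcard := Finset.card_sdiff_add_card_eq_card hsub
    have hdim := finrank_differenceSpan_add_two_le hAne hBne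
    rcases Nat.eq_zero_or_pos n with rfl | hn
    · omega
    obtain ⟨a₀, ha₀⟩ := Finset.card_pos.1 (hA'.symm ▸ hn)
    obtain ⟨b₀, hb₀⟩ := Finset.card_pos.1 (hB'.symm ▸ hn)
    set S := differenceSpan (A.erase u) (B.erase v) with hS
    have : FiniteDimensional ℚ S := by
      have h1 := finiteDimensional_vectorSpan_of_finite ℚ (A.erase u).finite_toSet
      have h2 := finiteDimensional_vectorSpan_of_finite ℚ (B.erase v).finite_toSet
      exact Submodule.finiteDimensional_sup _ _
    have hext : ∀ S' : Submodule ℚ W, S ≤ S' → u - a₀ ∈ S' → v - b₀ ∈ S' →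
        differenceSpan A B ≤ S' := by
      intro S' hSS' h1 h2
      refine (differenceSpan_le_iff (Finset.mem_of_mem_erase ha₀)
        (Finset.mem_of_mem_erase hb₀) _).2 ⟨fun a ha => ?_, fun b hb => ?_⟩
      · by_cases h : a = u
        · exact h ▸ h1
        · exact hSS' (sub_mem_differenceSpan_left (Finset.mem_erase.2 ⟨h, ha⟩) ha₀)
      · by_cases h : b = v
        · exact h ▸ h2
        · exact hSS' (sub_mem_differenceSpan_right (Finset.mem_erase.2 ⟨h, hb⟩) hb₀)
    by_cases hle : u - a₀ ∈ S ∧ v - b₀ ∈ S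
    · have hf := Submodule.finrank_mono (hext S le_rfl hle.1 hle.2)
      nlinarith
    · have huv : u + v ∉ A.erase u + B.erase v := fun h => by
        obtain ⟨a, ha, b, hb, hab⟩ := Finset.mem_add.1 h
        have := congrArg φ hab
        rw [map_add, map_add] at this
        linarith [hminA a ha, hminB b hb]
      have hbig : n + 1 ≤ ((A + B) \ (A.erase u + B.erase v)).card := by
        rcases not_and_or.1 hle with h | h
        · have := card_le_card_sdiff_of_sub_notMem hu ha₀ huv h
          rwa [hB] at this
        · rw [hS, differenceSpan_comm] at h
          rw [add_comm u v, add_comm (A.erase u)] at huv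
          have := card_le_card_sdiff_of_sub_notMem hv hb₀ huv h
          rwa [add_comm B A, add_comm (B.erase v), hA] at this
      have hstep : Module.finrank ℚ (differenceSpan A B) ≤ Module.finrank ℚ S + 2 := by
        set P := Submodule.span ℚ (({u - a₀, v - b₀} : Finset W) : Set W) with hP
        have hPdim : Module.finrank ℚ P ≤ 2 :=
          (finrank_span_finset_le_card _).trans Finset.card_le_two
        have hPmem : ∀ x ∈ ({u - a₀, v - b₀} : Finset W), x ∈ S ⊔ P := fun x hx =>
          Submodule.mem_sup_right (Submodule.subset_span hx)
        have hf := Submodule.finrank_mono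
          (hext (S ⊔ P) le_sup_left (hPmem _ (by simp)) (hPmem _ (by simp)))
        have := Submodule.finrank_add_le_finrank_add_finrank S P
        omega
      nlinarith

end Sumset

section Relations

open Module
open scoped Pointwise

variable {k : ℕ}

/-- The linear form on `ι → ℚ` with the integer coefficients `x`. -/
def coefficientForm {ι : Type*} [Fintype ι] (x : ι → ℤ) : (ι → ℚ) →ₗ[ℚ] ℚ :=
  Fintype.linearCombination ℚ fun i => (x i : ℚ)

@[simp]
lemma coefficientForm_single {ι : Type*} [Fintype ι] [DecidableEq ι] (x : ι → ℤ) (i : ι) :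
    coefficientForm x (Pi.single i 1) = x i := by
  simp [coefficientForm, Fintype.linearCombination_apply_single]

open Classical in
/-- Boundedly many integer points are annihilated by a given subspace. -/
lemma card_filter_le_ker_coefficientForm {ι : Type*} [Fintype ι] [DecidableEq ι]
    (K : Submodule ℚ (ι → ℚ)) (I : Finset ℤ) :
    ((Fintype.piFinset fun _ : ι => I).filter
      fun x => K ≤ LinearMap.ker (coefficientForm x)).card ≤
        I.card ^ finrank ℚ ((ι → ℚ) ⧸ K) := by
  obtain ⟨κ, a, ha, hspan, hli⟩ := exists_linearIndependent' ℚ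
    fun i : ι => K.mkQ (Pi.single i 1)
  have : Finite κ := Finite.of_injective a ha
  have := Fintype.ofFinite κ
  have htop : Submodule.span ℚ (Set.range fun i : ι => K.mkQ (Pi.single i (1 : ℚ))) = ⊤ := by
    have h1 : (Set.range fun i : ι => K.mkQ (Pi.single i (1 : ℚ))) =
        K.mkQ '' Set.range (Pi.basisFun ℚ ι) := by
      rw [← Set.range_comp]
      congr 1
      ext i
      simp
    rw [h1, Submodule.span_image, (Pi.basisFun ℚ ι).span_eq, Submodule.map_top,
      Submodule.range_mkQ]
  have hcard : Fintype.card κ = finrank ℚ ((ι → ℚ) ⧸ K) := by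
    rw [← finrank_span_eq_card hli, hspan, htop, finrank_top]
  calc _ ≤ (Fintype.piFinset fun _ : κ => I).card := by
        refine Finset.card_le_card_of_injOn (fun x => x ∘ a) ?_ ?_
        · intro x hx
          simp only [Finset.coe_filter, Fintype.mem_piFinset, Set.mem_ofPred_eq] at hx
          simp [hx.1]
        · intro x hx y hy hxy
          simp only [Finset.coe_filter, Fintype.mem_piFinset, Set.mem_ofPred_eq] at hx hy
          have hform : K.liftQ _ hx.2 = K.liftQ _ hy.2 := by
            refine LinearMap.ext_on_range (v := (fun i : ι => K.mkQ (Pi.single i (1 : ℚ))) ∘ a)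
              (hspan.trans htop) fun i => ?_
            have := congrFun hxy i
            simp only [Function.comp_apply] at this
            simp [this]
          ext i
          have := LinearMap.congr_fun hform (K.mkQ (Pi.single i 1))
          simpa using this
    _ = _ := by simp [hcard]

/-- The vector encoding the additive relation between the index pairs `t.1` and `t.2`. -/
def sumRelation (t : (Fin k × Fin k) × (Fin k × Fin k)) : Fin k ⊕ Fin k → ℚ :=
  Pi.single (.inl t.1.1) 1 + Pi.single (.inr t.1.2) 1 -
    (Pi.single (.inl t.2.1) 1 + Pi.single (.inr t.2.2) 1)

/-- The sum of one left and one right coordinate of `x`. -/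
def pairSum (x : Fin k ⊕ Fin k → ℤ) (p : Fin k × Fin k) : ℤ := x (.inl p.1) + x (.inr p.2)

/-- The span of the additive relations satisfied by `x`. -/
def relationSpan (x : Fin k ⊕ Fin k → ℤ) : Submodule ℚ (Fin k ⊕ Fin k → ℚ) :=
  Submodule.span ℚ (Set.range
    fun t : {t : (Fin k × Fin k) × (Fin k × Fin k) // pairSum x t.1 = pairSum x t.2} =>
      sumRelation t.1)

lemma relationSpan_le_ker (x : Fin k ⊕ Fin k → ℤ) :
    relationSpan x ≤ LinearMap.ker (coefficientForm x) := by
  rw [relationSpan, Submodule.span_le]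
  rintro _ ⟨⟨t, ht⟩, rfl⟩
  have : (pairSum x t.1 : ℚ) = pairSum x t.2 := by rw [ht]
  simp only [pairSum, Int.cast_add] at this
  simp [sumRelation, this]

/-- A configuration with many degrees of freedom has many sums. -/
lemma card_mul_finrank_le_card_pairSum (x : Fin k ⊕ Fin k → ℤ)
    (hl : Function.Injective (x ∘ Sum.inl)) (hr : Function.Injective (x ∘ Sum.inr)) :
    k * finrank ℚ ((Fin k ⊕ Fin k → ℚ) ⧸ relationSpan x) ≤
      4 * (Finset.univ.image (pairSum x)).card + k := by
  classical
  rcases Nat.eq_zero_or_pos k with rfl | hk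
  · simp
  set K := relationSpan x with hK
  set φ := K.liftQ _ (relationSpan_le_ker x) with hφ
  set e : Fin k ⊕ Fin k → (Fin k ⊕ Fin k → ℚ) ⧸ K := fun i => K.mkQ (Pi.single i 1) with he
  have hφe : ∀ i, φ (e i) = x i := fun i => by simp [hφ, he]
  set A := Finset.univ.image (e ∘ Sum.inl) with hA
  set B := Finset.univ.image (e ∘ Sum.inr) with hB
  have hinjl : Function.Injective (φ ∘ e ∘ Sum.inl) := by
    intro i j hij
    simp only [Function.comp_apply, hφe, Int.cast_inj] at hij
    exact hl hij
  have hinjr : Function.Injective (φ ∘ e ∘ Sum.inr) := by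
    intro i j hij
    simp only [Function.comp_apply, hφe, Int.cast_inj] at hij
    exact hr hij
  have hAcard : A.card = k := by
    rw [hA, Finset.card_image_of_injective _ hinjl.of_comp, Finset.card_univ, Fintype.card_fin]
  have hBcard : B.card = k := by
    rw [hB, Finset.card_image_of_injective _ hinjr.of_comp, Finset.card_univ, Fintype.card_fin]
  have hφA : Set.InjOn φ A := by
    intro a ha a' ha' h
    simp only [hA, Finset.coe_image, Finset.coe_univ, Set.image_univ, Set.mem_range] at ha ha'
    obtain ⟨i, rfl⟩ := ha
    obtain ⟨j, rfl⟩ := ha'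
    rw [hinjl h]
  have hφB : Set.InjOn φ B := by
    intro a ha a' ha' h
    simp only [hB, Finset.coe_image, Finset.coe_univ, Set.image_univ, Set.mem_range] at ha ha'
    obtain ⟨i, rfl⟩ := ha
    obtain ⟨j, rfl⟩ := ha'
    rw [hinjr h]
  have hmain := card_mul_finrank_differenceSpan_le φ k A B hAcard hBcard hφA hφB
  have hsums : (A + B).card ≤ (Finset.univ.image (pairSum x)).card := by
    have hAB : A + B ⊆ Finset.univ.image
        fun p : Fin k × Fin k => e (.inl p.1) + e (.inr p.2) := by
      intro y hy
      obtain ⟨a, ha, b, hb, rfl⟩ := Finset.mem_add.1 hy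
      obtain ⟨i, -, rfl⟩ := Finset.mem_image.1 ha
      obtain ⟨j, -, rfl⟩ := Finset.mem_image.1 hb
      exact Finset.mem_image.2 ⟨(i, j), Finset.mem_univ _, rfl⟩
    refine (Finset.card_le_card hAB).trans ?_
    have hφs : ∀ p : Fin k × Fin k, φ (e (.inl p.1) + e (.inr p.2)) = (pairSum x p : ℤ) :=
      fun p => by simp [hφe, pairSum]
    rw [← Finset.card_image_of_injective (Finset.univ.image (pairSum x))
      (Int.cast_injective (α := ℚ))]
    refine Finset.card_le_card_of_injOn φ ?_ ?_
    · intro y hy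
      obtain ⟨p, -, rfl⟩ := Finset.mem_image.1 (Finset.mem_coe.1 hy)
      rw [hφs]
      exact Finset.mem_coe.2 (Finset.mem_image_of_mem _
        (Finset.mem_image_of_mem _ (Finset.mem_univ _)))
    · intro y hy z hz hyz
      obtain ⟨p, -, rfl⟩ := Finset.mem_image.1 (Finset.mem_coe.1 hy)
      obtain ⟨q, -, rfl⟩ := Finset.mem_image.1 (Finset.mem_coe.1 hz)
      rw [hφs, hφs, Int.cast_inj] at hyz
      simp only [he, ← map_add]
      rw [← sub_eq_zero, ← map_sub, ← LinearMap.mem_ker, Submodule.ker_mkQ, hK]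
      exact Submodule.subset_span ⟨⟨(p, q), hyz⟩, rfl⟩
  have hdim : finrank ℚ ((Fin k ⊕ Fin k → ℚ) ⧸ K) ≤ finrank ℚ (differenceSpan A B) + 2 := by
    set u := e (.inl ⟨0, hk⟩)
    set v := e (.inr ⟨0, hk⟩)
    set P := Submodule.span ℚ (({u, v} : Finset _) : Set ((Fin k ⊕ Fin k → ℚ) ⧸ K)) with hP
    have hPdim : finrank ℚ P ≤ 2 :=
      (finrank_span_finset_le_card _).trans Finset.card_le_two
    have hPmem : ∀ y ∈ ({u, v} : Finset _), y ∈ P := fun y hy => Submodule.subset_span hy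
    have hmemA : ∀ i, e (.inl i) ∈ A := fun i =>
      Finset.mem_image.2 ⟨i, Finset.mem_univ _, rfl⟩
    have hmemB : ∀ i, e (.inr i) ∈ B := fun i =>
      Finset.mem_image.2 ⟨i, Finset.mem_univ _, rfl⟩
    have htop : differenceSpan A B ⊔ P = ⊤ := by
      have hbasis : ∀ i, e i ∈ differenceSpan A B ⊔ P := by
        rintro (i | i)
        · rw [← sub_add_cancel (e (.inl i)) u]
          exact Submodule.add_mem_sup (sub_mem_differenceSpan_left (hmemA _) (hmemA _))
            (hPmem _ (by simp))
        · rw [← sub_add_cancel (e (.inr i)) v]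
          exact Submodule.add_mem_sup (sub_mem_differenceSpan_right (hmemB _) (hmemB _))
            (hPmem _ (by simp))
      have hcomap : (⊤ : Submodule ℚ (Fin k ⊕ Fin k → ℚ)) ≤
          (differenceSpan A B ⊔ P).comap K.mkQ := by
        rw [← (Pi.basisFun ℚ (Fin k ⊕ Fin k)).span_eq, Submodule.span_le]
        rintro _ ⟨i, rfl⟩
        rw [Pi.basisFun_apply]
        exact hbasis i
      rw [eq_top_iff]
      intro y _
      obtain ⟨z, rfl⟩ := K.mkQ_surjective y
      exact hcomap (Submodule.mem_top (x := z))
    have := Submodule.finrank_add_le_finrank_add_finrank (differenceSpan A B) P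
    rw [htop, finrank_top] at this
    omega
  nlinarith

open Classical in
/-- The number of configurations with `d` degrees of freedom. -/
lemma card_filter_finrank_relationSpan_le (I : Finset ℤ) (d : ℕ) :
    ((Fintype.piFinset fun _ : Fin k ⊕ Fin k => I).filter
      fun x => finrank ℚ ((Fin k ⊕ Fin k → ℚ) ⧸ relationSpan x) = d).card ≤
        (k ^ 4).choose (2 * k - d) * I.card ^ d := by
  set F := fun R : Finset ((Fin k × Fin k) × (Fin k × Fin k)) =>
    (Fintype.piFinset fun _ : Fin k ⊕ Fin k => I).filter fun x =>
      relationSpan x = Submodule.span ℚ (sumRelation '' R) ∧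
        finrank ℚ ((Fin k ⊕ Fin k → ℚ) ⧸ relationSpan x) = d with hF
  have hFcard : ∀ R, (F R).card ≤ I.card ^ d := by
    intro R
    rcases (F R).eq_empty_or_nonempty with h | ⟨x, hx⟩
    · simp [h]
    · rw [hF, Finset.mem_filter] at hx
      rw [← hx.2.2, hx.2.1]
      refine le_trans (Finset.card_le_card ?_) (card_filter_le_ker_coefficientForm _ I)
      intro y hy
      rw [hF, Finset.mem_filter] at hy
      exact Finset.mem_filter.2 ⟨hy.1, hy.2.1 ▸ relationSpan_le_ker y⟩
  have hcover : ((Fintype.piFinset fun _ : Fin k ⊕ Fin k => I).filter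
      fun x => finrank ℚ ((Fin k ⊕ Fin k → ℚ) ⧸ relationSpan x) = d) ⊆
        (Finset.powersetCard (2 * k - d) Finset.univ).biUnion F := by
    intro x hx
    obtain ⟨hxI, hxd⟩ := Finset.mem_filter.1 hx
    obtain ⟨κ, a, ha, hspan, hli⟩ := exists_linearIndependent' ℚ
      fun t : {t : (Fin k × Fin k) × (Fin k × Fin k) // pairSum x t.1 = pairSum x t.2} =>
        sumRelation t.1
    have : Finite κ := Finite.of_injective a ha
    have := Fintype.ofFinite κ
    have hcard : Fintype.card κ = 2 * k - d := by
      rw [← finrank_span_eq_card hli, hspan]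
      have := Submodule.finrank_quotient_add_finrank (relationSpan x)
      rw [hxd, finrank_pi, Fintype.card_sum, Fintype.card_fin] at this
      change finrank ℚ (relationSpan x) = _
      omega
    refine Finset.mem_biUnion.2 ⟨Finset.univ.image (Subtype.val ∘ a), ?_, ?_⟩
    · rw [Finset.mem_powersetCard, Finset.card_image_of_injective _
        (Subtype.val_injective.comp ha)]
      exact ⟨Finset.subset_univ _, hcard⟩
    · refine Finset.mem_filter.2 ⟨hxI, ?_, hxd⟩
      rw [relationSpan, ← hspan]
      congr 1
      ext y
      simp
  calc _ ≤ _ := Finset.card_le_card hcover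
    _ ≤ _ := Finset.card_biUnion_le_card_mul _ _ _ fun R _ => hFcard R
    _ = _ := by
      rw [Finset.card_powersetCard, Finset.card_univ]
      simp only [Fintype.card_prod, Fintype.card_fin]
      congr 2
      ring

end Relations

section Coloring

open Module
open scoped Pointwise

/-- The union bound for colorings avoiding monochromatic sets. -/
lemma exists_coloring_no_monochromatic {α ι : Type*} [Fintype α] (F : Finset ι)
    (S : ι → Finset α) (q : ℕ) (hq : 0 < q)
    (h : ∑ i ∈ F, (q : ℝ) / (q : ℝ) ^ (S i).card < 1) :
    ∃ g : α → Fin q, ∀ i ∈ F, ∀ c, ∃ y ∈ S i, g y ≠ c := by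
  classical
  by_contra! hbad
  set E := fun p : ι × Fin q =>
    Fintype.piFinset fun y : α => if y ∈ S p.1 then {p.2} else (Finset.univ : Finset (Fin q))
    with hE
  have hEcard : ∀ p, ((E p).card : ℝ) = (q : ℝ) ^ Fintype.card α / (q : ℝ) ^ (S p.1).card := by
    intro p
    have h1 : (E p).card = q ^ (Fintype.card α - (S p.1).card) := by
      rw [hE, Fintype.card_piFinset]
      simp only [apply_ite Finset.card, Finset.card_singleton, Finset.card_univ,
        Fintype.card_fin]
      rw [Finset.prod_ite, Finset.prod_const_one, one_mul, Finset.prod_const,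
        ← Finset.card_compl]
      congr 2
      ext y
      simp
    rw [h1, Nat.cast_pow, pow_sub₀ _ (by positivity) (Finset.card_le_univ _), div_eq_mul_inv]
  have hcover : (Finset.univ : Finset (α → Fin q)) ⊆ (F ×ˢ Finset.univ).biUnion E := by
    intro g _
    obtain ⟨i, hi, c, hc⟩ := hbad g
    refine Finset.mem_biUnion.2 ⟨(i, c), by simp [hi], Fintype.mem_piFinset.2 fun y => ?_⟩
    by_cases hy : y ∈ S i
    · simp [hy, hc y hy]
    · simp [hy]
  have hle := (Finset.card_le_card hcover).trans Finset.card_biUnion_le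
  rw [Finset.card_univ, Fintype.card_fun, Fintype.card_fin] at hle
  have hle' : (q : ℝ) ^ Fintype.card α ≤ ∑ p ∈ F ×ˢ (Finset.univ : Finset (Fin q)),
      ((E p).card : ℝ) := by exact_mod_cast hle
  have hsum : ∑ p ∈ F ×ˢ (Finset.univ : Finset (Fin q)), ((E p).card : ℝ) =
      (q : ℝ) ^ Fintype.card α * ∑ i ∈ F, (q : ℝ) / (q : ℝ) ^ (S i).card := by
    simp only [hEcard]
    rw [Finset.sum_product, Finset.mul_sum]
    refine Finset.sum_congr rfl fun i _ => ?_
    simp only [Finset.sum_const, Finset.card_univ, Fintype.card_fin, nsmul_eq_mul]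
    ring
  rw [hsum] at hle'
  have : (0 : ℝ) < (q : ℝ) ^ Fintype.card α := by positivity
  nlinarith

lemma pow_self_le_four_pow_mul_factorial (r : ℕ) : r ^ r ≤ 4 ^ r * r.factorial := by
  have h := Real.pow_div_factorial_le_exp (r : ℝ) (Nat.cast_nonneg r) r
  rw [div_le_iff₀ (by positivity)] at h
  have h4 : Real.exp r ≤ 4 ^ r := by
    rw [← Real.exp_one_pow]
    exact pow_le_pow_left₀ (Real.exp_pos 1).le (by linarith [Real.exp_one_lt_d9]) r
  have : (r : ℝ) ^ r ≤ 4 ^ r * r.factorial := h.trans (by gcongr)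
  exact_mod_cast this

lemma choose_pow_four_le {k r : ℕ} (hk : 0 < k) (hr : r ≤ 2 * k) :
    (k ^ 4).choose r ≤ (4 * k ^ 3) ^ (2 * k) := by
  rcases le_total r k with hrk | hkr
  · calc (k ^ 4).choose r ≤ (k ^ 4) ^ r := Nat.choose_le_pow _ _
      _ ≤ (k ^ 4) ^ k := Nat.pow_le_pow_right (by positivity) hrk
      _ = k ^ (4 * k) := (pow_mul k 4 k).symm
      _ ≤ k ^ (6 * k) := Nat.pow_le_pow_right hk (by omega)
      _ = (k ^ 3) ^ (2 * k) := by rw [← pow_mul]; congr 1; ring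
      _ ≤ _ := Nat.pow_le_pow_left (by omega) _
  · refine le_trans ?_ (Nat.pow_le_pow_right (by positivity) hr)
    refine Nat.le_of_mul_le_mul_left ?_ r.factorial_pos
    calc r.factorial * (k ^ 4).choose r = (k ^ 4).descFactorial r :=
          (Nat.descFactorial_eq_factorial_mul_choose _ _).symm
      _ ≤ (k ^ 4) ^ r := Nat.descFactorial_le_pow _ _
      _ = k ^ r * (k ^ 3) ^ r := by rw [← mul_pow]; congr 1; ring
      _ ≤ r ^ r * (k ^ 3) ^ r := by gcongr
      _ ≤ (4 ^ r * r.factorial) * (k ^ 3) ^ r := by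
          gcongr; exact pow_self_le_four_pow_mul_factorial r
      _ = _ := by rw [mul_pow]; ring

lemma configuration_bound_mul_le_pow {k d s : ℕ} (hk : 5 ≤ k) (hs : 2 * k ≤ s + 1)
    (hds : k * d ≤ 4 * s + k) :
    (2 * k + 2) * ((4 * k ^ 3) ^ (2 * k) * 2 ^ ((k + 1) * d)) * (2 ^ 24 * k ^ 3) ≤
      (2 ^ 24 * k ^ 3) ^ s := by
  obtain ⟨t, rfl⟩ : ∃ t, s = t + 1 := ⟨s - 1, by omega⟩
  rw [pow_succ (2 ^ 24 * k ^ 3)]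
  refine Nat.mul_le_mul_right _ ?_
  have hk1 : k + 1 ≤ 2 ^ k := Nat.lt_two_pow_self
  have h2 : 2 * k + 2 ≤ 2 ^ (k + 1) := by rw [pow_succ]; omega
  have h3 : k ^ (6 * k) ≤ 2 ^ (6 * k) * k ^ (3 * t) := by
    calc k ^ (6 * k) ≤ k ^ (6 + 3 * t) := Nat.pow_le_pow_right (by omega) (by omega)
      _ = k ^ 6 * k ^ (3 * t) := pow_add _ _ _
      _ ≤ (2 ^ k) ^ 6 * k ^ (3 * t) := by gcongr; omega
      _ = _ := by rw [← pow_mul, mul_comm k 6]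
  have h4 : (4 * k ^ 3) ^ (2 * k) = 2 ^ (4 * k) * k ^ (6 * k) := by
    rw [mul_pow, ← pow_mul, show (4 : ℕ) = 2 ^ 2 by norm_num, ← pow_mul]
    congr 2 <;> ring
  calc (2 * k + 2) * ((4 * k ^ 3) ^ (2 * k) * 2 ^ ((k + 1) * d))
      ≤ 2 ^ (k + 1) * ((2 ^ (4 * k) * (2 ^ (6 * k) * k ^ (3 * t))) * 2 ^ ((k + 1) * d)) := by
        rw [h4]; gcongr
    _ = 2 ^ ((k + 1) + 4 * k + 6 * k + (k + 1) * d) * k ^ (3 * t) := by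
        simp only [pow_add]; ring
    _ ≤ 2 ^ (24 * t) * k ^ (3 * t) := by
        refine Nat.mul_le_mul_right _ (Nat.pow_le_pow_right (by norm_num) ?_)
        nlinarith
    _ = _ := by rw [mul_pow, ← pow_mul, ← pow_mul]

lemma two_mul_le_card_pairSum_add_one {k : ℕ} (hk : 0 < k) (x : Fin k ⊕ Fin k → ℤ)
    (hl : Function.Injective (x ∘ Sum.inl)) (hr : Function.Injective (x ∘ Sum.inr)) :
    2 * k ≤ (Finset.univ.image (pairSum x)).card + 1 := by
  have : Nonempty (Fin k) := ⟨⟨0, hk⟩⟩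
  have h := cauchy_davenport_add_of_linearOrder_isCancelAdd
    (Finset.univ_nonempty.image (x ∘ Sum.inl)) (Finset.univ_nonempty.image (x ∘ Sum.inr))
  rw [Finset.card_image_of_injective _ hl, Finset.card_image_of_injective _ hr,
    Finset.card_univ, Fintype.card_fin] at h
  have hsub : Finset.univ.image (x ∘ Sum.inl) + Finset.univ.image (x ∘ Sum.inr) ⊆
      Finset.univ.image (pairSum x) := by
    intro y hy
    obtain ⟨a, ha, b, hb, rfl⟩ := Finset.mem_add.1 hy
    obtain ⟨i, -, rfl⟩ := Finset.mem_image.1 ha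
    obtain ⟨j, -, rfl⟩ := Finset.mem_image.1 hb
    exact Finset.mem_image.2 ⟨(i, j), Finset.mem_univ _, rfl⟩
  have := Finset.card_le_card hsub
  omega

/-- There is a coloring of an initial interval with `O(k ^ 3)` colors and no monochromatic
sumset of two `k`-element sets. -/
lemma exists_coloring_no_monochromatic_sumset {k N M : ℕ} (hk : 5 ≤ k) (hN : N ≤ 2 ^ k) :
    ∃ g : Fin M → Fin (2 ^ 24 * k ^ 3), ∀ x : Fin k ⊕ Fin k → ℤ,
      (∀ i, x i ∈ Finset.Ico (-N : ℤ) N) → Function.Injective (x ∘ Sum.inl) →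
      Function.Injective (x ∘ Sum.inr) → (∀ p, pairSum x p ∈ Finset.Ico (0 : ℤ) M) →
      ∀ c, ∃ (y : Fin M) (p : Fin k × Fin k), (y : ℤ) = pairSum x p ∧ g y ≠ c := by
  classical
  set q := 2 ^ 24 * k ^ 3 with hq
  have hqpos : 0 < q := by positivity
  set I := Finset.Ico (-N : ℤ) N with hI
  have hIcard : I.card ≤ 2 ^ (k + 1) := by
    rw [hI, Int.card_Ico, pow_succ]; omega
  set F := (Fintype.piFinset fun _ : Fin k ⊕ Fin k => I).filter fun x =>
    Function.Injective (x ∘ Sum.inl) ∧ Function.Injective (x ∘ Sum.inr) ∧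
      ∀ p, pairSum x p ∈ Finset.Ico (0 : ℤ) M with hF
  set S := fun x : Fin k ⊕ Fin k → ℤ =>
    Finset.univ.filter fun y : Fin M => ∃ p, (y : ℤ) = pairSum x p with hS
  set D := fun x : Fin k ⊕ Fin k → ℤ =>
    finrank ℚ ((Fin k ⊕ Fin k → ℚ) ⧸ relationSpan x) with hD
  set b := fun d : ℕ => (4 * k ^ 3) ^ (2 * k) * 2 ^ ((k + 1) * d) with hb
  have hbpos : ∀ d, 0 < b d := fun d => by positivity
  have hDlt : ∀ x ∈ F, D x ∈ Finset.range (2 * k + 1) := by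
    intro x _
    have := Submodule.finrank_quotient_add_finrank (relationSpan x)
    rw [finrank_pi, Fintype.card_sum, Fintype.card_fin] at this
    rw [Finset.mem_range]
    simp only [hD]
    omega
  have hcount : ∀ d, (F.filter fun x => D x = d).card ≤ b d := by
    intro d
    calc _ ≤ _ := Finset.card_le_card (Finset.filter_subset_filter _ (Finset.filter_subset _ _))
      _ ≤ _ := card_filter_finrank_relationSpan_le I d
      _ ≤ (4 * k ^ 3) ^ (2 * k) * (2 ^ (k + 1)) ^ d :=
          Nat.mul_le_mul (choose_pow_four_le (by omega) (Nat.sub_le _ _))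
            (Nat.pow_le_pow_left hIcard d)
      _ = b d := by rw [← pow_mul]
  have hterm : ∀ x ∈ F, (q : ℝ) / (q : ℝ) ^ (S x).card ≤ 1 / ((2 * k + 2) * b (D x)) := by
    intro x hx
    obtain ⟨-, hl, hr, hp⟩ := Finset.mem_filter.1 hx
    have hcard : (Finset.univ.image (pairSum x)).card ≤ (S x).card := by
      rw [← Finset.card_image_of_injective (S x)
        (Nat.cast_injective (R := ℤ) |>.comp Fin.val_injective)]
      refine Finset.card_le_card fun z hz => ?_
      obtain ⟨p, -, rfl⟩ := Finset.mem_image.1 hz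
      have := Finset.mem_Ico.1 (hp p)
      have hcast : ((pairSum x p).toNat : ℤ) = pairSum x p := Int.toNat_of_nonneg this.1
      refine Finset.mem_image.2 ⟨⟨(pairSum x p).toNat, by omega⟩, ?_, hcast⟩
      exact Finset.mem_filter.2 ⟨Finset.mem_univ _, p, hcast⟩
    have h1 := two_mul_le_card_pairSum_add_one (by omega) x hl hr
    have h2 := card_mul_finrank_le_card_pairSum x hl hr
    have h3 : (2 * k + 2) * b (D x) * q ≤ q ^ (S x).card :=
      configuration_bound_mul_le_pow hk (by omega) (by simp only [hD]; omega)
    have h3' : ((2 * k + 2) * b (D x) * q : ℝ) ≤ (q : ℝ) ^ (S x).card := by exact_mod_cast h3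
    have hb' : (0 : ℝ) < b (D x) := by exact_mod_cast hbpos _
    rw [div_le_div_iff₀ (by positivity) (by positivity)]
    linarith
  have hsum : ∑ x ∈ F, (q : ℝ) / (q : ℝ) ^ (S x).card < 1 := by
    rw [← Finset.sum_fiberwise_of_maps_to hDlt]
    calc _ ≤ ∑ d ∈ Finset.range (2 * k + 1), (1 / (2 * k + 2) : ℝ) := by
          refine Finset.sum_le_sum fun d _ => ?_
          have hb' : (0 : ℝ) < b d := by exact_mod_cast hbpos d
          calc _ ≤ ∑ x ∈ F.filter fun x => D x = d, (1 / ((2 * k + 2) * b d) : ℝ) := by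
                refine Finset.sum_le_sum fun x hx => ?_
                obtain ⟨hxF, rfl⟩ := Finset.mem_filter.1 hx
                exact hterm x hxF
            _ = ((F.filter fun x => D x = d).card : ℝ) * (1 / ((2 * k + 2) * b d)) := by
                rw [Finset.sum_const, nsmul_eq_mul]
            _ ≤ b d * (1 / ((2 * k + 2) * b d)) := by
                gcongr
                exact hcount d
            _ = _ := by field_simp
      _ = (2 * k + 1) / (2 * k + 2) := by
          rw [Finset.sum_const, Finset.card_range, nsmul_eq_mul]; push_cast; ring
      _ < 1 := by
          rw [div_lt_one (by positivity)]; linarith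
  obtain ⟨g, hg⟩ := exists_coloring_no_monochromatic F S q hqpos hsum
  refine ⟨g, fun x hxI hl hr hp c => ?_⟩
  obtain ⟨y, hy, hyc⟩ := hg x (Finset.mem_filter.2
    ⟨Fintype.mem_piFinset.2 hxI, hl, hr, hp⟩) c
  obtain ⟨p, hyp⟩ := (Finset.mem_filter.1 hy).2
  exact ⟨y, p, hyp, hyc⟩

end Coloring

section Circulant

/-- A rectangle of a circulant matrix supported on a short interval lifts to the integers. -/
lemma exists_integer_lift {k N M : ℕ} (hk : 0 < k) (hM : 2 * M ≤ N) (a b : Fin k → Fin N)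
    (ha : Function.Injective a) (hb : Function.Injective b)
    (h : ∀ i j, ((a i : ℕ) + (b j : ℕ)) % N < M) :
    ∃ x : Fin k ⊕ Fin k → ℤ, (∀ i, x i ∈ Finset.Ico (-N : ℤ) N) ∧
      Function.Injective (x ∘ Sum.inl) ∧ Function.Injective (x ∘ Sum.inr) ∧
      (∀ p, pairSum x p ∈ Finset.Ico (0 : ℤ) M) ∧
      ∀ i j, pairSum x (i, j) = (((a i : ℕ) + (b j : ℕ)) % N : ℕ) := by
  set o : Fin k := ⟨0, hk⟩
  set s : Fin k → Fin k → ℤ := fun i j => (((a i : ℕ) + (b j : ℕ)) % N : ℕ) with hs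
  have hs0 : ∀ i j, 0 ≤ s i j := fun i j => Int.natCast_nonneg _
  have hsM : ∀ i j, s i j < M := fun i j => Int.ofNat_lt.2 (h i j)
  have hmod : ∀ i j, ∃ z : ℤ, s i j = a i + b j + N * z := fun i j =>
    ⟨-(((a i : ℤ) + b j) / N), by
      simp only [hs]; push_cast; rw [Int.emod_def]; ring⟩
  have huniq : ∀ (y y' z : ℤ), y = y' + N * z → |y - y'| < N → y = y' := by
    intro y y' z hy hlt
    have : y - y' = 0 := Int.eq_zero_of_abs_lt_dvd ⟨z, by linarith⟩ hlt
    linarith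
  have hadd : ∀ i j, s i o + (s o j - s o o) = s i j := by
    intro i j
    obtain ⟨z₁, h₁⟩ := hmod i o
    obtain ⟨z₂, h₂⟩ := hmod o j
    obtain ⟨z₃, h₃⟩ := hmod o o
    obtain ⟨z₄, h₄⟩ := hmod i j
    refine huniq _ _ (z₁ + z₂ - z₃ - z₄) (by rw [h₁, h₂, h₃, h₄]; ring) ?_
    have := hs0 i o; have := hs0 o j; have := hs0 o o; have := hs0 i j
    have := hsM i o; have := hsM o j; have := hsM o o; have := hsM i j
    rw [abs_lt]
    constructor <;> omega
  refine ⟨Sum.elim (fun i => s i o) (fun j => s o j - s o o), ?_, ?_, ?_, ?_, ?_⟩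
  · rintro (i | j) <;> simp only [Sum.elim_inl, Sum.elim_inr, Finset.mem_Ico]
    · have := hs0 i o; have := hsM i o; omega
    · have := hs0 o j; have := hsM o j; have := hs0 o o; have := hsM o o; omega
  · intro i j hij
    simp only [Function.comp_apply, Sum.elim_inl] at hij
    obtain ⟨z₁, h₁⟩ := hmod i o
    obtain ⟨z₂, h₂⟩ := hmod j o
    refine ha (Fin.ext ?_)
    exact_mod_cast huniq (a i) (a j) (z₂ - z₁) (by linarith)
      (by rw [abs_lt]; have := (a i).2; have := (a j).2; constructor <;> omega)
  · intro i j hij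
    simp only [Function.comp_apply, Sum.elim_inr] at hij
    obtain ⟨z₁, h₁⟩ := hmod o i
    obtain ⟨z₂, h₂⟩ := hmod o j
    refine hb (Fin.ext ?_)
    exact_mod_cast huniq (b i) (b j) (z₂ - z₁) (by linarith)
      (by rw [abs_lt]; have := (b i).2; have := (b j).2; constructor <;> omega)
  · rintro ⟨i, j⟩
    simp only [pairSum, Sum.elim_inl, Sum.elim_inr, hadd, Finset.mem_Ico]
    exact ⟨hs0 i j, hsM i j⟩
  · intro i j
    simp only [pairSum, Sum.elim_inl, Sum.elim_inr, hadd]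
    rfl

/-- Every element of the row contributes `N` entries to the circulant matrix. -/
lemma mul_card_le_card_filter_circulant {N M : ℕ} (hM : M ≤ N) (c : ℕ → Bool)
    (T : Finset (Fin M)) (hT : ∀ y ∈ T, c y = true) :
    N * T.card ≤ (Finset.univ.filter
      (fun p : Fin N × Fin N => c (((p.1 : ℕ) + (p.2 : ℕ)) % N) = true)).card := by
  have hsum : ∀ (i : Fin N) (y : Fin M), ((i : ℕ) + ((y : ℕ) + N - i) % N) % N = y := by
    intro i y
    have := i.2
    have := y.2
    rw [Nat.add_mod_mod, show (i : ℕ) + ((y : ℕ) + N - i) = y + N by omega, Nat.add_mod_right,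
      Nat.mod_eq_of_lt (by omega)]
  calc N * T.card = ((Finset.univ : Finset (Fin N)) ×ˢ T).card := by
        rw [Finset.card_product, Finset.card_univ, Fintype.card_fin]
    _ ≤ _ := by
      refine Finset.card_le_card_of_injOn
        (fun p => (p.1, ⟨((p.2 : ℕ) + N - p.1) % N, Nat.mod_lt _ (by have := p.1.2; omega)⟩))
        ?_ ?_
      · rintro ⟨i, y⟩ hp
        have hy : y ∈ T := (Finset.mem_product.1 (Finset.mem_coe.1 hp)).2
        refine Finset.mem_coe.2 (Finset.mem_filter.2 ⟨Finset.mem_univ _, ?_⟩)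
        simp only [hsum]
        exact hT y hy
      · rintro ⟨i, y⟩ - ⟨j, z⟩ - hpq
        simp only [Prod.mk.injEq, Fin.mk.injEq] at hpq
        obtain ⟨rfl, h⟩ := hpq
        have h1 := hsum i y
        rw [h, hsum i z] at h1
        rw [Fin.ext h1]

end Circulant

/-- Corollary: there are constants `c₀ > 0` and `N₀` such that for every `N ≥ N₀`,
with `k = ⌈log₂ N⌉`, there is a circulant `N × N` Boolean matrix
`M i j = c ((i + j) mod N)` that is `(k,k)`-free (contains no all-ones `k × k`
submatrix) and has weight at least `c₀ · N² / (log₂ N)³`. -/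
theorem exists_thin_circulant_log :
    ∃ c₀ : ℝ, 0 < c₀ ∧ ∃ N₀ : ℕ, ∀ N : ℕ, N₀ ≤ N →
      ∃ c : ℕ → Bool,
        (¬ ∃ (a : Fin (Nat.clog 2 N) → Fin N) (b : Fin (Nat.clog 2 N) → Fin N),
            Function.Injective a ∧ Function.Injective b ∧
            ∀ i j, c (((a i : ℕ) + (b j : ℕ)) % N) = true) ∧
        c₀ * (N : ℝ) ^ 2 / (Real.logb 2 N) ^ 3 ≤
          ((Finset.univ.filter
            (fun p : Fin N × Fin N => c (((p.1 : ℕ) + (p.2 : ℕ)) % N) = true)).card : ℝ) := by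
  refine ⟨1 / (3 * 2 ^ 27), by positivity, 32, fun N hN => ?_⟩
  set k := Nat.clog 2 N with hk
  set M := N / 2 with hM
  set q := 2 ^ 24 * k ^ 3 with hq
  have hk5 : 5 ≤ k := by
    calc 5 = Nat.clog 2 (2 ^ 5) := (Nat.clog_pow 2 5 (by norm_num)).symm
      _ ≤ k := Nat.clog_mono_right 2 hN
  have hqpos : 0 < q := by positivity
  obtain ⟨g, hg⟩ := exists_coloring_no_monochromatic_sumset (M := M) hk5
    (Nat.le_pow_clog (by norm_num) N)
  obtain ⟨col, hcol⟩ : ∃ col : Fin q, M ≤ q * (Finset.univ.filter fun y => g y = col).card := by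
    have : Nonempty (Fin q) := ⟨⟨0, hqpos⟩⟩
    obtain ⟨col, -, hmax⟩ := Finset.exists_max_image Finset.univ
      (fun col => (Finset.univ.filter fun y => g y = col).card) Finset.univ_nonempty
    refine ⟨col, ?_⟩
    calc M = (Finset.univ : Finset (Fin M)).card := by simp
      _ = ∑ col, (Finset.univ.filter fun y => g y = col).card :=
          Finset.card_eq_sum_card_fiberwise fun _ _ => Finset.mem_univ _
      _ ≤ (Finset.univ : Finset (Fin q)).card • (Finset.univ.filter fun y => g y = col).card :=
          Finset.sum_le_card_nsmul _ _ _ hmax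
      _ = _ := by simp
  set T := Finset.univ.filter fun y => g y = col with hT
  refine ⟨fun n => decide (∃ h : n < M, g ⟨n, h⟩ = col), ?_, ?_⟩
  · rintro ⟨a, b, ha, hb, hab⟩
    simp only [decide_eq_true_eq] at hab
    obtain ⟨x, hxI, hl, hr, hp, hx⟩ := exists_integer_lift (M := M) (by omega) (by omega) a b ha hb
      fun i j => (hab i j).1
    obtain ⟨y, ⟨i, j⟩, hy, hyc⟩ := hg x hxI hl hr hp col
    obtain ⟨h, hc⟩ := hab i j
    refine hyc ?_
    rw [← hc]
    congr 1
    apply Fin.ext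
    have := hy.trans (hx i j)
    exact_mod_cast this
  · have hw := mul_card_le_card_filter_circulant (M := M) (N := N) (by omega)
      (fun n => decide (∃ h : n < M, g ⟨n, h⟩ = col)) T fun y hy => by
        simpa using (Finset.mem_filter.1 hy).2
    refine le_trans ?_ (Nat.cast_le.2 hw)
    have hNpos : (0 : ℝ) < N := by exact_mod_cast (by omega : 0 < N)
    set L := Real.logb 2 N with hL
    have hpred : 2 ^ (k - 1) ≤ N := (Nat.pow_pred_clog_lt_self (by norm_num) (by omega)).le
    have hkL : (k : ℝ) - 1 ≤ L := by
      rw [hL, Real.le_logb_iff_rpow_le (by norm_num) hNpos]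
      have : ((k - 1 : ℕ) : ℝ) = (k : ℝ) - 1 := by
        rw [Nat.cast_sub (by omega), Nat.cast_one]
      rw [← this, Real.rpow_natCast]
      exact_mod_cast hpred
    have hk5' : (5 : ℝ) ≤ k := by exact_mod_cast hk5
    have hk2L : (k : ℝ) ≤ 2 * L := by linarith
    have hLpos : 0 < L := by linarith
    have hqL : (q : ℝ) ≤ 2 ^ 27 * L ^ 3 := by
      calc (q : ℝ) = 2 ^ 24 * (k : ℝ) ^ 3 := by rw [hq]; push_cast; ring
        _ ≤ 2 ^ 24 * (2 * L) ^ 3 := by gcongr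
        _ = _ := by ring
    have hNM : (N : ℝ) ≤ 3 * (q * T.card) := by
      have : N ≤ 3 * (q * T.card) := by omega
      exact_mod_cast this
    rw [div_le_iff₀ (by positivity), Nat.cast_mul]
    have hTnn : (0 : ℝ) ≤ T.card := Nat.cast_nonneg _
    have hNT : (N : ℝ) ≤ 3 * (2 ^ 27 * L ^ 3 * T.card) :=
      hNM.trans (by gcongr)
    nlinarith
end
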